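/- For a ∈ (0,a*) let u_a be a minimizer of e(a), ε_a = (∫_{ℝ²}|∇|u_a||² dx)^{−1/2}, x_a a global maximum point of |u_a|, and w_a(x) = ε_a u_a(ε_a x + x_a) e^{−i((ε_a Ω/2) x·x_a^⊥ − θ_a)}. Then the function x ↦ ε_a² ∫_{ℝ²} ln|x−y| |w_a(y)|² dy belongs to C^α_loc(ℝ²), and the family {ε_a² ∫_{ℝ²} ln|x−y| |w_a(y)|² dy}_{a} is bounded uniformly in C^α(B_R(0)) for every R > 0 as a ↗ a*, i.e. there exists C(R) > 0 independent of a (for a near a*) bounding both the sup-norm on B_R(0) and the α-Hölder seminorm on B_R(0). -/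

import Mathlib

open MeasureTheory Filter Topology Set Metric

noncomputable section

/-- The plane `ℝ²` with the Euclidean norm. -/
abbrev Plane : Type := EuclideanSpace ℝ (Fin 2)

def e0 : Plane := EuclideanSpace.single (0 : Fin 2) (1 : ℝ)
def e1 : Plane := EuclideanSpace.single (1 : Fin 2) (1 : ℝ)

/-- Partial derivatives of a complex-valued function. -/
def d0 (u : Plane → ℂ) (x : Plane) : ℂ := fderiv ℝ u x e0
def d1 (u : Plane → ℂ) (x : Plane) : ℂ := fderiv ℝ u x e1

/-- `|∇u|²` for complex-valued `u`. -/
def gradSq (u : Plane → ℂ) (x : Plane) : ℝ := ‖d0 u x‖ ^ 2 + ‖d1 u x‖ ^ 2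

/-- `|∇|u||²`. -/
def gradAbsSq (u : Plane → ℂ) (x : Plane) : ℝ := ‖fderiv ℝ (fun y => ‖u y‖) x‖ ^ 2

/-- Membership in `H¹(ℝ², ℂ)` (smooth-representative formulation). -/
def InH1 (u : Plane → ℂ) : Prop :=
  Differentiable ℝ u ∧ Integrable (fun x => ‖u x‖ ^ 2) ∧ Integrable (gradSq u)

/-- Membership in the space `𝓗 = {u ∈ H¹ : ∫ V |u|² < ∞}`. -/
def InH (V : Plane → ℝ) (u : Plane → ℂ) : Prop :=
  InH1 u ∧ Integrable (fun x => V x * ‖u x‖ ^ 2)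

/-- The constraint set `S_a`. -/
def Sset (V : Plane → ℝ) (a : ℝ) : Set (Plane → ℂ) :=
  {u | InH V u ∧ (∫ x : Plane, ‖u x‖ ^ 2) = a}

/-- The momentum density `x^⊥ · (iu, ∇u)`, with `x^⊥ = (-x₂, x₁)` and
`(iu,∇u)_j = Im(ū ∂_j u)`. -/
def momentum (u : Plane → ℂ) (x : Plane) : ℝ :=
  (-(x 1)) * ((starRingEnd ℂ) (u x) * d0 u x).im + (x 0) * ((starRingEnd ℂ) (u x) * d1 u x).im

/-- The logarithmic convolution term `∫∫ ln|x-y| |u(x)|²|u(y)|²`. -/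
def logConv (u : Plane → ℂ) : ℝ :=
  ∫ x : Plane, ∫ y : Plane, Real.log ‖x - y‖ * ‖u x‖ ^ 2 * ‖u y‖ ^ 2

/-- The energy functional `E_a`. -/
def Ea (V : Plane → ℝ) (Ω : ℝ) (u : Plane → ℂ) : ℝ :=
  (∫ x : Plane, (gradSq u x + V x * ‖u x‖ ^ 2)) + (1 / 2) * logConv u
    - (1 / 2) * (∫ x : Plane, ‖u x‖ ^ 4) - Ω * (∫ x : Plane, momentum u x)

/-- `u` is a minimizer of `e(a) = inf_{S_a} E_a`. -/
def IsMinimizer (V : Plane → ℝ) (Ω a : ℝ) (u : Plane → ℂ) : Prop :=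
  u ∈ Sset V a ∧ ∀ v ∈ Sset V a, Ea V Ω u ≤ Ea V Ω v

/-- `e(a) = inf_{u ∈ S_a} E_a(u)`. -/
def eInf (V : Plane → ℝ) (Ω a : ℝ) : ℝ := sInf (Ea V Ω '' Sset V a)

/-- `f(x) → ∞` as `|x| → ∞`. -/
def TendsInfty (f : Plane → ℝ) : Prop := ∀ M : ℝ, ∃ R : ℝ, ∀ x : Plane, R ≤ ‖x‖ → M ≤ f x

/-- Hypotheses (1.10): `0 ≤ V ∈ L^∞_loc` and `liminf_{|x|→∞} V(x)/|x|² > 0`. -/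
def V110 (V : Plane → ℝ) : Prop :=
  Measurable V ∧ (∀ x, 0 ≤ V x) ∧
  (∀ R : ℝ, ∃ C : ℝ, ∀ x : Plane, ‖x‖ ≤ R → V x ≤ C) ∧
  (∃ c : ℝ, 0 < c ∧ ∃ R : ℝ, ∀ x : Plane, R ≤ ‖x‖ → c * ‖x‖ ^ 2 ≤ V x)

/-- The set of rotational velocities `W > 0` with `V(x) - (W²/4)|x|² → ∞`;
`Ω* = sup RotSet V`. -/
def RotSet (V : Plane → ℝ) : Set ℝ :=
  {W : ℝ | 0 < W ∧ TendsInfty (fun x => V x - W ^ 2 / 4 * ‖x‖ ^ 2)}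

/-- `Ω < Ω*` where `Ω* = sup RotSet V` (possibly `+∞`). -/
def SubCritical (V : Plane → ℝ) (Ω : ℝ) : Prop := ∃ W ∈ RotSet V, Ω < W

def d0R (q : Plane → ℝ) (x : Plane) : ℝ := fderiv ℝ q x e0
def d1R (q : Plane → ℝ) (x : Plane) : ℝ := fderiv ℝ q x e1

/-- `|∇q|²` for real-valued `q`. -/
def gradSqR (q : Plane → ℝ) (x : Plane) : ℝ := (d0R q x) ^ 2 + (d1R q x) ^ 2

/-- The Laplacian of a real-valued function. -/
def lapR (q : Plane → ℝ) (x : Plane) : ℝ := fderiv ℝ (d0R q) x e0 + fderiv ℝ (d1R q) x e1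

/-- `Q` is the positive radially symmetric `H¹` solution of `-ΔQ + Q - Q³ = 0` on `ℝ²`. -/
def IsGroundState (Q : Plane → ℝ) : Prop :=
  ContDiff ℝ 2 Q ∧ (∀ x, 0 < Q x) ∧ (∀ x y : Plane, ‖x‖ = ‖y‖ → Q x = Q y) ∧
  Integrable (fun x => (Q x) ^ 2) ∧ Integrable (fun x => ‖fderiv ℝ Q x‖ ^ 2) ∧
  (∀ x, - lapR Q x + Q x - (Q x) ^ 3 = 0)

/-- The Laplacian of a complex-valued function. -/
def lapC (u : Plane → ℂ) (x : Plane) : ℂ := fderiv ℝ (d0 u) x e0 + fderiv ℝ (d1 u) x e1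

/-- The Euler–Lagrange equation (1.18):
`-Δu + V u + (∫ ln|x-y||u(y)|² dy) u + iΩ (x^⊥·∇u) = μ u + |u|² u`. -/
def EulerLagrange (V : Plane → ℝ) (Ω : ℝ) (u : Plane → ℂ) (μ : ℝ) : Prop :=
  ∀ x : Plane,
    - lapC u x + (V x : ℂ) * u x
      + (((∫ y : Plane, Real.log ‖x - y‖ * ‖u y‖ ^ 2) : ℝ) : ℂ) * u x
      + Complex.I * (Ω : ℂ) * (((-(x 1) : ℝ) : ℂ) * d0 u x + ((x 0 : ℝ) : ℂ) * d1 u x)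
    = (μ : ℂ) * u x + ((‖u x‖ ^ 2 : ℝ) : ℂ) * u x

/-- Condition (V): `0 ≤ V_Ω ∈ C^α_loc`, `V_Ω` vanishes only at the origin, and `V` has at
most exponential growth. Here `V_Ω(x) = V(x) - (Ω²/4)|x|²`. -/
def CondV (V : Plane → ℝ) (Ω α : ℝ) : Prop :=
  α ∈ Ioo (0 : ℝ) 1 ∧
  (∀ x : Plane, 0 ≤ V x - Ω ^ 2 / 4 * ‖x‖ ^ 2) ∧
  (∀ x : Plane, V x - Ω ^ 2 / 4 * ‖x‖ ^ 2 = 0 ↔ x = 0) ∧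
  (∀ R : ℝ, 0 < R → ∃ C : ℝ, ∀ x ∈ closedBall (0 : Plane) R, ∀ y ∈ closedBall (0 : Plane) R,
    |(V x - Ω ^ 2 / 4 * ‖x‖ ^ 2) - (V y - Ω ^ 2 / 4 * ‖y‖ ^ 2)| ≤ C * ‖x - y‖ ^ α) ∧
  (∃ C γ : ℝ, 0 < γ ∧ ∀ x : Plane, V x ≤ C * Real.exp (γ * ‖x‖))

/-- `ε_a = (∫ |∇|u_a||²)^{-1/2}` for a family of minimizers. -/
def epsOf (u : ℝ → Plane → ℂ) (a : ℝ) : ℝ :=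
  (∫ x : Plane, gradAbsSq (u a) x) ^ (-(1 : ℝ) / 2)

/-- The rescaled family
`w_a(y) = ε_a u_a(ε_a y + x_a) e^{-i((ε_a Ω/2) y·x_a^⊥ - θ)}`. -/
def wfam (Ω : ℝ) (u : ℝ → Plane → ℂ) (xa : ℝ → Plane) (a θv : ℝ) (y : Plane) : ℂ :=
  ((epsOf u a : ℝ) : ℂ) * u a ((epsOf u a) • y + xa a) *
    Complex.exp (-Complex.I *
      ((((epsOf u a * Ω / 2) * (-(y 0) * (xa a 1) + (y 1) * (xa a 0)) - θv) : ℝ) : ℂ))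

/-- The limit profile `(1/√a*) Q(x/√a*)` where `a* = ‖Q‖₂²`. -/
def Qstar (Q : Plane → ℝ) (x : Plane) : ℝ :=
  (Real.sqrt (∫ y : Plane, (Q y) ^ 2))⁻¹ * Q ((Real.sqrt (∫ y : Plane, (Q y) ^ 2))⁻¹ • x)

open Real in
lemma abs_log_le_add_rpow {α r : ℝ} (hα : 0 < α) (hr : 0 ≤ r) :
    |log r| ≤ log (1 + r) + r ^ (-α) / α := by
  have h1 : 0 ≤ log (1 + r) := log_nonneg (by linarith)
  rcases hr.eq_or_lt with rfl | hr
  · simp only [log_zero, abs_zero]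
    positivity
  have h2 : log r ≤ log (1 + r) := log_le_log hr (by linarith)
  have h3 : -log r ≤ r ^ (-α) / α := by
    rw [le_div_iff₀ hα, ← log_inv]
    have := log_le_self (x := r ^ (-α)) (by positivity)
    rw [log_rpow hr] at this
    rw [log_inv]
    linarith
  have h4 : 0 ≤ r ^ (-α) / α := by positivity
  rw [abs_le]
  constructor <;> linarith

lemma neg_log_le_rpow {α r : ℝ} (hα : 0 < α) (hr : 0 ≤ r) :
    -(r ^ (-α) / α) ≤ Real.log r := by
  rcases hr.eq_or_lt with rfl | hr
  · simp only [Real.log_zero]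
    have : (0 : ℝ) ≤ 0 ^ (-α) / α := by positivity
    linarith
  rw [neg_le, le_div_iff₀ hα]
  have := Real.log_le_self (x := r ^ (-α)) (by positivity)
  rw [Real.log_rpow hr] at this
  linarith

lemma log_sub_log_le {α r s : ℝ} (hα : 0 < α) (hα1 : α < 1) (hs : 0 < s) (hrs : s ≤ r) :
    Real.log r - Real.log s ≤ (r - s) ^ α * s ^ (-α) / α := by
  have hr : 0 < r := hs.trans_le hrs
  rw [← Real.log_div hr.ne' hs.ne', le_div_iff₀ hα]
  have h0 : 0 ≤ (r - s) / s := div_nonneg (by linarith) hs.le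
  have h1 : r / s = 1 + (r - s) / s := by field_simp; ring
  have h2 : (r / s) ^ α ≤ 1 + ((r - s) / s) ^ α := by
    rw [h1]
    simpa using Real.rpow_add_le_add_rpow zero_le_one h0 hα.le hα1.le
  have h3 : Real.log ((r / s) ^ α) ≤ (r / s) ^ α - 1 :=
    Real.log_le_sub_one_of_pos (by positivity)
  rw [Real.log_rpow (by positivity)] at h3
  have h4 : ((r - s) / s) ^ α = (r - s) ^ α * s ^ (-α) := by
    rw [Real.div_rpow (by linarith) hs.le, Real.rpow_neg hs.le]
    rfl
  linarith

lemma abs_log_norm_sub_log_norm_le {α : ℝ} (hα : 0 < α) (hα1 : α < 1) {x y p : Plane}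
    (hx : x ≠ p) (hy : y ≠ p) :
    |Real.log ‖x - p‖ - Real.log ‖y - p‖| ≤
      ‖x - y‖ ^ α / α * (‖x - p‖ ^ (-α) + ‖y - p‖ ^ (-α)) := by
  wlog h : ‖y - p‖ ≤ ‖x - p‖ generalizing x y
  · rw [abs_sub_comm, norm_sub_rev x y, add_comm]
    exact this hy hx (le_of_not_ge h)
  have hy0 : 0 < ‖y - p‖ := norm_pos_iff.2 (sub_ne_zero.2 hy)
  have h1 := log_sub_log_le hα hα1 hy0 h
  rw [abs_of_nonneg (sub_nonneg.2 (Real.log_le_log hy0 h))]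
  have h2 : (‖x - p‖ - ‖y - p‖) ^ α ≤ ‖x - y‖ ^ α := by
    refine Real.rpow_le_rpow (by linarith) ?_ hα.le
    simpa using norm_sub_norm_le (x - p) (y - p)
  calc _ ≤ _ := h1
    _ ≤ ‖x - y‖ ^ α * ‖y - p‖ ^ (-α) / α := by gcongr
    _ = ‖x - y‖ ^ α / α * (0 + ‖y - p‖ ^ (-α)) := by ring
    _ ≤ _ := by gcongr; positivity

lemma integral_add_add {f g h : Plane → ℝ} (hf : Integrable f) (hg : Integrable g)
    (hh : Integrable h) :
    ∫ x, (f x + g x + h x) = (∫ x, f x) + (∫ x, g x) + ∫ x, h x :=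
  (integral_add (hf.add hg) hh).trans (by rw [← integral_add hf hg]; rfl)

lemma finrank_plane : Module.finrank ℝ Plane = 2 := by simp

lemma integrableOn_norm_rpow_neg {α : ℝ} (hα1 : α < 1) :
    IntegrableOn (fun y : Plane => ‖y‖ ^ (-(2 * α))) (ball 0 1) := by
  rw [integrableOn_fun_norm_addHaar volume (f := fun r : ℝ => r ^ (-(2 * α))), finrank_plane]
  have h : IntegrableOn (fun r : ℝ => r ^ (1 - 2 * α)) (Ioo 0 1) := by
    rw [intervalIntegral.integrableOn_Ioo_rpow_iff zero_lt_one]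
    linarith
  refine h.congr_fun (fun r hr => ?_) measurableSet_Ioo
  simp only [smul_eq_mul]
  rw [sub_eq_add_neg, Real.rpow_add hr.1]
  simp

/-- The integral over the unit disc of the squared Riesz kernel `|y|^{-α}`. -/
def rieszJ (α : ℝ) : ℝ := ∫ y in ball (0 : Plane) 1, ‖y‖ ^ (-(2 * α))

lemma rieszJ_nonneg (α : ℝ) : 0 ≤ rieszJ α :=
  integral_nonneg fun _ => Real.rpow_nonneg (norm_nonneg _) _

/-- The bound on the Riesz potential of `f` in terms of its first two moments. -/
def rieszC (α : ℝ) (f : Plane → ℝ) : ℝ := rieszJ α + (∫ y, f y ^ 2) + ∫ y, f y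

lemma rieszC_nonneg (α : ℝ) {f : Plane → ℝ} (hf : ∀ x, 0 ≤ f x) : 0 ≤ rieszC α f :=
  add_nonneg (add_nonneg (rieszJ_nonneg α) (integral_nonneg fun _ => sq_nonneg _))
    (integral_nonneg hf)

section Potential

variable {α : ℝ} {f : Plane → ℝ}

lemma riesz_pointwise_le (hα : 0 < α) (hf : ∀ x, 0 ≤ f x) (x y : Plane) :
    ‖x - y‖ ^ (-α) * f y ≤
      (ball (0 : Plane) 1).indicator (fun z => ‖z‖ ^ (-(2 * α))) (x - y) + f y ^ 2 + f y := by
  by_cases h : x - y ∈ ball (0 : Plane) 1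
  · rw [indicator_of_mem h]
    have h1 : ‖x - y‖ ^ (-(2 * α)) = (‖x - y‖ ^ (-α)) ^ 2 := by
      rw [← Real.rpow_natCast, ← Real.rpow_mul (norm_nonneg _)]
      congr 1
      push_cast
      ring
    rw [h1]
    nlinarith [sq_nonneg (‖x - y‖ ^ (-α) - f y), hf y, sq_nonneg (‖x - y‖ ^ (-α)),
      sq_nonneg (f y)]
  · rw [indicator_of_notMem h]
    have h1 : 1 ≤ ‖x - y‖ := by simpa using h
    have h2 : ‖x - y‖ ^ (-α) ≤ 1 := Real.rpow_le_one_of_one_le_of_nonpos h1 (by linarith)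
    nlinarith [hf y, sq_nonneg (f y)]

lemma integrable_riesz_majorant (hα1 : α < 1) (hfi : Integrable f)
    (hf2 : Integrable fun y => f y ^ 2) (x : Plane) :
    Integrable (fun y => (ball (0 : Plane) 1).indicator (fun z => ‖z‖ ^ (-(2 * α))) (x - y)
      + f y ^ 2 + f y) := by
  have h := (integrable_indicator_iff measurableSet_ball).2 (integrableOn_norm_rpow_neg hα1)
  exact ((h.comp_sub_left x).add hf2).add hfi

lemma integrable_riesz (hα : 0 < α) (hα1 : α < 1) (hf : ∀ x, 0 ≤ f x) (hfi : Integrable f)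
    (hf2 : Integrable fun y => f y ^ 2) (x : Plane) :
    Integrable (fun y => ‖x - y‖ ^ (-α) * f y) := by
  refine (integrable_riesz_majorant hα1 hfi hf2 x).mono' ?_ (ae_of_all _ fun y => ?_)
  · have h : Measurable fun y : Plane => ‖x - y‖ ^ (-α) := by fun_prop
    exact h.aestronglyMeasurable.mul hfi.1
  · rw [Real.norm_of_nonneg (mul_nonneg (by positivity) (hf y))]
    exact riesz_pointwise_le hα hf x y

lemma integral_riesz_le (hα : 0 < α) (hα1 : α < 1) (hf : ∀ x, 0 ≤ f x) (hfi : Integrable f)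
    (hf2 : Integrable fun y => f y ^ 2) (x : Plane) :
    ∫ y, ‖x - y‖ ^ (-α) * f y ≤ rieszC α f := by
  have h := (integrable_indicator_iff measurableSet_ball).2 (integrableOn_norm_rpow_neg hα1)
  calc _ ≤ _ := integral_mono (integrable_riesz hα hα1 hf hfi hf2 x)
        (integrable_riesz_majorant hα1 hfi hf2 x) (fun y => riesz_pointwise_le hα hf x y)
    _ = rieszC α f := by
      rw [integral_add_add (h.comp_sub_left x) hf2 hfi,
        integral_sub_left_eq_self (fun z => (ball (0 : Plane) 1).indicator
          (fun z : Plane => ‖z‖ ^ (-(2 * α))) z) volume x, integral_indicator measurableSet_ball]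
      rfl

lemma log_one_add_norm_sub_le (x y : Plane) :
    Real.log (1 + ‖x - y‖) ≤ Real.log (1 + ‖x‖) + ‖y‖ := by
  have h1 : 1 + ‖x - y‖ ≤ (1 + ‖x‖) * (1 + ‖y‖) := by
    nlinarith [norm_sub_le x y, norm_nonneg x, norm_nonneg y,
      mul_nonneg (norm_nonneg x) (norm_nonneg y)]
  calc _ ≤ Real.log ((1 + ‖x‖) * (1 + ‖y‖)) := Real.log_le_log (by positivity) h1
    _ = Real.log (1 + ‖x‖) + Real.log (1 + ‖y‖) :=
      Real.log_mul (by positivity) (by positivity)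
    _ ≤ _ := by
      have := Real.log_le_sub_one_of_pos (x := 1 + ‖y‖) (by positivity)
      linarith

lemma abs_log_mul_le (hα : 0 < α) (hf : ∀ x, 0 ≤ f x) (x y : Plane) :
    |Real.log ‖x - y‖ * f y| ≤
      Real.log (1 + ‖x‖) * f y + ‖y‖ * f y + α⁻¹ * (‖x - y‖ ^ (-α) * f y) := by
  rw [abs_mul, abs_of_nonneg (hf y)]
  have h1 := abs_log_le_add_rpow hα (norm_nonneg (x - y))
  have h2 := log_one_add_norm_sub_le x y
  calc _ ≤ (Real.log (1 + ‖x‖) + ‖y‖ + ‖x - y‖ ^ (-α) / α) * f y :=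
        mul_le_mul_of_nonneg_right (by linarith) (hf y)
    _ = _ := by ring

lemma integrable_log_majorant (hα : 0 < α) (hα1 : α < 1) (hf : ∀ x, 0 ≤ f x)
    (hfi : Integrable f) (hf2 : Integrable fun y => f y ^ 2)
    (hfm : Integrable fun y => ‖y‖ * f y) (x : Plane) :
    Integrable (fun y => Real.log (1 + ‖x‖) * f y + ‖y‖ * f y
      + α⁻¹ * (‖x - y‖ ^ (-α) * f y)) :=
  ((hfi.const_mul _).add hfm).add ((integrable_riesz hα hα1 hf hfi hf2 x).const_mul _)

lemma integrable_log_mul (hα : 0 < α) (hα1 : α < 1) (hf : ∀ x, 0 ≤ f x)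
    (hfi : Integrable f) (hf2 : Integrable fun y => f y ^ 2)
    (hfm : Integrable fun y => ‖y‖ * f y) (x : Plane) :
    Integrable (fun y => Real.log ‖x - y‖ * f y) := by
  refine (integrable_log_majorant hα hα1 hf hfi hf2 hfm x).mono' ?_ (ae_of_all _ fun y => ?_)
  · have h : Measurable fun y : Plane => Real.log ‖x - y‖ := by fun_prop
    exact h.aestronglyMeasurable.mul hfi.1
  · exact abs_log_mul_le hα hf x y

lemma integral_abs_log_mul_le (hα : 0 < α) (hα1 : α < 1) (hf : ∀ x, 0 ≤ f x)
    (hfi : Integrable f) (hf2 : Integrable fun y => f y ^ 2)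
    (hfm : Integrable fun y => ‖y‖ * f y) (x : Plane) :
    ∫ y, |Real.log ‖x - y‖ * f y| ≤
      Real.log (1 + ‖x‖) * (∫ y, f y) + (∫ y, ‖y‖ * f y) + α⁻¹ * rieszC α f := by
  have hr := integrable_riesz hα hα1 hf hfi hf2 x
  calc _ ≤ _ := integral_mono (integrable_log_mul hα hα1 hf hfi hf2 hfm x).abs
        (integrable_log_majorant hα hα1 hf hfi hf2 hfm x) (fun y => abs_log_mul_le hα hf x y)
    _ = Real.log (1 + ‖x‖) * (∫ y, f y) + (∫ y, ‖y‖ * f y)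
        + α⁻¹ * ∫ y, ‖x - y‖ ^ (-α) * f y := by
      rw [integral_add_add (hfi.const_mul _) hfm (hr.const_mul _),
        integral_const_mul, integral_const_mul]
    _ ≤ _ := by
      gcongr
      exact integral_riesz_le hα hα1 hf hfi hf2 x

lemma le_integral_log_mul (hα : 0 < α) (hα1 : α < 1) (hf : ∀ x, 0 ≤ f x)
    (hfi : Integrable f) (hf2 : Integrable fun y => f y ^ 2)
    (hfm : Integrable fun y => ‖y‖ * f y) (x : Plane) :
    -(α⁻¹ * rieszC α f) ≤ ∫ y, Real.log ‖x - y‖ * f y := by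
  have hr := integrable_riesz hα hα1 hf hfi hf2 x
  calc _ ≤ -(α⁻¹ * ∫ y, ‖x - y‖ ^ (-α) * f y) := by
        gcongr
        exact integral_riesz_le hα hα1 hf hfi hf2 x
    _ = ∫ y, -(α⁻¹ * (‖x - y‖ ^ (-α) * f y)) := by rw [integral_neg, integral_const_mul]
    _ ≤ _ := by
      refine integral_mono (hr.const_mul _).neg (integrable_log_mul hα hα1 hf hfi hf2 hfm x)
        fun y => ?_
      have := mul_le_mul_of_nonneg_right (neg_log_le_rpow hα (norm_nonneg (x - y))) (hf y)
      calc _ = -(‖x - y‖ ^ (-α) / α) * f y := by ring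
        _ ≤ _ := this

lemma abs_log_potential_sub_le (hα : 0 < α) (hα1 : α < 1) (hf : ∀ x, 0 ≤ f x)
    (hfi : Integrable f) (hf2 : Integrable fun y => f y ^ 2)
    (hfm : Integrable fun y => ‖y‖ * f y) (x y : Plane) :
    |(∫ p, Real.log ‖x - p‖ * f p) - ∫ p, Real.log ‖y - p‖ * f p| ≤
      2 * α⁻¹ * rieszC α f * ‖x - y‖ ^ α := by
  have hx := integrable_riesz hα hα1 hf hfi hf2 x
  have hy := integrable_riesz hα hα1 hf hfi hf2 y
  rw [← integral_sub (integrable_log_mul hα hα1 hf hfi hf2 hfm x)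
    (integrable_log_mul hα hα1 hf hfi hf2 hfm y)]
  calc _ ≤ ∫ p, |Real.log ‖x - p‖ * f p - Real.log ‖y - p‖ * f p| :=
        abs_integral_le_integral_abs
    _ ≤ ∫ p, ‖x - y‖ ^ α / α * (‖x - p‖ ^ (-α) * f p + ‖y - p‖ ^ (-α) * f p) := by
      refine integral_mono_ae ((integrable_log_mul hα hα1 hf hfi hf2 hfm x).sub
        (integrable_log_mul hα hα1 hf hfi hf2 hfm y)).abs ((hx.add hy).const_mul _) ?_
      filter_upwards [Measure.ae_ne volume x, Measure.ae_ne volume y] with p hpx hpy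
      rw [← sub_mul, abs_mul, abs_of_nonneg (hf p)]
      calc _ ≤ _ := mul_le_mul_of_nonneg_right
            (abs_log_norm_sub_log_norm_le hα hα1 hpx.symm hpy.symm) (hf p)
        _ = _ := by ring
    _ = ‖x - y‖ ^ α / α *
        ((∫ p, ‖x - p‖ ^ (-α) * f p) + ∫ p, ‖y - p‖ ^ (-α) * f p) := by
      rw [integral_const_mul, integral_add hx hy]
    _ ≤ ‖x - y‖ ^ α / α * (rieszC α f + rieszC α f) := by
      gcongr
      · exact integral_riesz_le hα hα1 hf hfi hf2 x
      · exact integral_riesz_le hα hα1 hf hfi hf2 y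
    _ = _ := by ring

lemma integrable_prod_log_mul (hα : 0 < α) (hα1 : α < 1) (hf : ∀ x, 0 ≤ f x)
    (hfi : Integrable f) (hf2 : Integrable fun y => f y ^ 2)
    (hfm : Integrable fun y => ‖y‖ * f y) :
    Integrable (fun z : Plane × Plane => Real.log ‖z.1 - z.2‖ * f z.1 * f z.2)
      (volume.prod volume) := by
  have hmeas : AEStronglyMeasurable
      (fun z : Plane × Plane => Real.log ‖z.1 - z.2‖ * f z.1 * f z.2) (volume.prod volume) := by
    have h : Measurable fun z : Plane × Plane => Real.log ‖z.1 - z.2‖ := by fun_prop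
    exact (h.aestronglyMeasurable.mul hfi.1.comp_fst).mul hfi.1.comp_snd
  have hlog : ∀ x : Plane, Real.log (1 + ‖x‖) ≤ ‖x‖ := fun x => by
    have := Real.log_le_sub_one_of_pos (x := 1 + ‖x‖) (by positivity)
    linarith
  rw [integrable_prod_iff hmeas]
  have hpt : ∀ x y : Plane, Real.log ‖x - y‖ * f x * f y = f x * (Real.log ‖x - y‖ * f y) :=
    fun x y => by ring
  refine ⟨ae_of_all _ fun x => ?_, ?_⟩
  · simp only [hpt]
    exact (integrable_log_mul hα hα1 hf hfi hf2 hfm x).const_mul _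
  · refine (((hfm.mul_const (∫ y, f y)).add (hfi.mul_const (∫ y, ‖y‖ * f y))).add
      (hfi.mul_const (α⁻¹ * rieszC α f))).mono' hmeas.norm.integral_prod_right'
      (ae_of_all _ fun x => ?_)
    rw [Real.norm_of_nonneg (integral_nonneg fun _ => norm_nonneg _)]
    have h0 : ∀ y, ‖Real.log ‖x - y‖ * f x * f y‖ = f x * |Real.log ‖x - y‖ * f y| := fun y => by
      rw [hpt, norm_mul, Real.norm_of_nonneg (hf x), Real.norm_eq_abs]
    simp only [h0, integral_const_mul]
    have h1 := integral_abs_log_mul_le hα hα1 hf hfi hf2 hfm x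
    have h2 : Real.log (1 + ‖x‖) * ∫ y, f y ≤ ‖x‖ * ∫ y, f y :=
      mul_le_mul_of_nonneg_right (hlog x) (integral_nonneg hf)
    calc _ ≤ f x * (‖x‖ * (∫ y, f y) + (∫ y, ‖y‖ * f y) + α⁻¹ * rieszC α f) :=
          mul_le_mul_of_nonneg_left (by linarith) (hf x)
      _ = _ := by simp only [Pi.add_apply]; ring

end Potential

lemma abs_le_integral_abs_deriv {g g' : ℝ → ℝ} (hg : ∀ x, HasDerivAt g (g' x) x)
    (hgi : Integrable g) (hgi' : Integrable g') (x : ℝ) : |g x| ≤ ∫ s, |g' s| := by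
  have h0 := tendsto_zero_of_hasDerivAt_of_integrableOn_Iic (a := x) (fun s _ => hg s)
    hgi'.integrableOn hgi.integrableOn
  have h1 := integral_Iic_of_hasDerivAt_of_tendsto' (a := x) (fun s _ => hg s)
    hgi'.integrableOn h0
  rw [sub_zero] at h1
  rw [← h1]
  exact abs_integral_le_integral_abs.trans
    (setIntegral_le_integral hgi'.abs (ae_of_all _ fun _ => abs_nonneg _))

lemma ladyzhenskaya_prod {F G₁ G₂ : ℝ × ℝ → ℝ} (hF : Integrable F) (hG₁ : Integrable G₁)
    (hG₂ : Integrable G₂) (h₁ : ∀ x y, HasDerivAt (fun s => F (s, y)) (G₁ (x, y)) x)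
    (h₂ : ∀ x y, HasDerivAt (fun s => F (x, s)) (G₂ (x, y)) y) :
    Integrable (fun z => F z ^ 2) ∧
      ∫ z, F z ^ 2 ≤ (∫ z, |G₁ z|) * ∫ z, |G₂ z| := by
  set A : ℝ → ℝ := fun y => ∫ s, |G₁ (s, y)|
  set B : ℝ → ℝ := fun x => ∫ s, |G₂ (x, s)|
  have hA : Integrable A := hG₁.abs.integral_prod_right
  have hB : Integrable B := hG₂.abs.integral_prod_left
  have hBA : Integrable (fun z : ℝ × ℝ => B z.1 * A z.2) := hB.mul_prod hA
  have hyA : ∀ᵐ y : ℝ, ∀ x, |F (x, y)| ≤ A y := by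
    filter_upwards [hF.prod_left_ae, hG₁.prod_left_ae] with y hy hy'
    exact fun x => abs_le_integral_abs_deriv (fun s => h₁ s y) hy hy' x
  have hxB : ∀ᵐ x : ℝ, ∀ y, |F (x, y)| ≤ B x := by
    filter_upwards [hF.prod_right_ae, hG₂.prod_right_ae] with x hx hx'
    exact fun y => abs_le_integral_abs_deriv (fun s => h₂ x s) hx hx' y
  have hle : ∀ᵐ z : ℝ × ℝ, F z ^ 2 ≤ B z.1 * A z.2 := by
    filter_upwards [Measure.quasiMeasurePreserving_snd.ae hyA,
      Measure.quasiMeasurePreserving_fst.ae hxB] with z hz hz'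
    rw [← sq_abs, sq]
    exact mul_le_mul (hz' z.2) (hz z.1) (abs_nonneg _) ((abs_nonneg _).trans (hz' z.2))
  have hF2 : Integrable (fun z => F z ^ 2) := by
    refine hBA.mono' (hF.1.pow 2) ?_
    filter_upwards [hle] with z hz
    rwa [Real.norm_of_nonneg (sq_nonneg _)]
  refine ⟨hF2, (integral_mono_ae hF2 hBA hle).trans_eq ?_⟩
  calc ∫ z : ℝ × ℝ, B z.1 * A z.2 = (∫ x, B x) * ∫ y, A y := integral_prod_mul B A
    _ = (∫ z, |G₁ z|) * ∫ z, |G₂ z| := by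
      rw [mul_comm]
      congr 1
      · exact integral_integral_symm (f := fun y s => |G₁ (s, y)|) hG₁.abs.swap |>.trans rfl
      · exact integral_integral (f := fun x s => |G₂ (x, s)|) hG₂.abs

/-- The measurable identification of `ℝ × ℝ` with the plane. -/
def prodPlane : ℝ × ℝ ≃ᵐ Plane :=
  (MeasurableEquiv.finTwoArrow (α := ℝ)).symm.trans (MeasurableEquiv.toLp 2 (Fin 2 → ℝ))

lemma measurePreserving_prodPlane : MeasurePreserving prodPlane :=
  (volume_preserving_finTwoArrow ℝ).symm.trans (PiLp.volume_preserving_toLp (Fin 2))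

lemma prodPlane_fst (x y s : ℝ) : prodPlane (s, y) = prodPlane (x, y) + (s - x) • e0 := by
  ext i
  fin_cases i <;> simp [prodPlane, e0, MeasurableEquiv.finTwoArrow]

lemma prodPlane_snd (x y s : ℝ) : prodPlane (x, s) = prodPlane (x, y) + (s - y) • e1 := by
  ext i
  fin_cases i <;> simp [prodPlane, e1, MeasurableEquiv.finTwoArrow]

lemma ladyzhenskaya {f : Plane → ℝ} (hf : Differentiable ℝ f) (hfi : Integrable f)
    (h0 : Integrable (d0R f)) (h1 : Integrable (d1R f)) :
    Integrable (fun x => f x ^ 2) ∧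
      ∫ x, f x ^ 2 ≤ (∫ x, |d0R f x|) * ∫ x, |d1R f x| := by
  have hmp := measurePreserving_prodPlane
  have hint : ∀ g : Plane → ℝ, Integrable g → Integrable (fun z => g (prodPlane z)) :=
    fun g hg => (hmp.integrable_comp_emb prodPlane.measurableEmbedding).2 hg
  have hder : ∀ (p v : Plane) (x₀ : ℝ),
      HasDerivAt (fun s : ℝ => f (p + (s - x₀) • v)) (fderiv ℝ f p v) x₀ := fun p v x₀ => by
    have hl : HasDerivAt (fun s : ℝ => p + (s - x₀) • v) v x₀ := by
      simpa using (((hasDerivAt_id x₀).sub_const x₀).smul_const v).const_add p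
    have hp : HasFDerivAt f (fderiv ℝ f p) (p + (x₀ - x₀) • v) := by
      simpa using (hf p).hasFDerivAt
    exact hp.comp_hasDerivAt x₀ hl
  have key := ladyzhenskaya_prod (hint f hfi) (hint _ h0) (hint _ h1)
    (fun x y => (hder (prodPlane (x, y)) e0 x).congr_of_eventuallyEq
      (.of_forall fun s => congrArg f (prodPlane_fst x y s)))
    (fun x y => (hder (prodPlane (x, y)) e1 y).congr_of_eventuallyEq
      (.of_forall fun s => congrArg f (prodPlane_snd x y s)))
  rw [hmp.integral_comp' (fun x => f x ^ 2), hmp.integral_comp' (fun x => |d0R f x|),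
    hmp.integral_comp' (fun x => |d1R f x|)] at key
  exact ⟨(hmp.integrable_comp_emb prodPlane.measurableEmbedding
    (g := fun x => f x ^ 2)).1 key.1, key.2⟩

lemma norm_e0 : ‖e0‖ = 1 := by simp [e0]

lemma norm_e1 : ‖e1‖ = 1 := by simp [e1]

lemma norm_sq_plane (x : Plane) : ‖x‖ ^ 2 = x 0 ^ 2 + x 1 ^ 2 := by
  rw [EuclideanSpace.real_norm_sq_eq, Fin.sum_univ_two]

/-- The density `|u|²`. -/
def dens (u : Plane → ℂ) (x : Plane) : ℝ := ‖u x‖ ^ 2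

lemma dens_nonneg (u : Plane → ℂ) (x : Plane) : 0 ≤ dens u x := sq_nonneg _

/-- The density of the part of the energy that is quadratic in `u`. -/
def linDens (V : Plane → ℝ) (Ω : ℝ) (u : Plane → ℂ) (x : Plane) : ℝ :=
  gradSq u x + V x * dens u x - Ω * momentum u x

section Calculus

variable {u : Plane → ℂ}

lemma differentiable_dens (hu : Differentiable ℝ u) : Differentiable ℝ (dens u) :=
  fun x => (hu x).norm_sq ℝ

lemma fderiv_dens (hu : Differentiable ℝ u) (x v : Plane) :
    fderiv ℝ (dens u) x v = 2 * ((starRingEnd ℂ) (u x) * fderiv ℝ u x v).re := by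
  have h : HasFDerivAt (dens u) _ x := (hu x).hasFDerivAt.norm_sq
  rw [h.fderiv]
  simp
  ring

lemma abs_fderiv_dens_le (hu : Differentiable ℝ u) (x v : Plane) :
    |fderiv ℝ (dens u) x v| ≤ 2 * ‖u x‖ * ‖fderiv ℝ (fun y => ‖u y‖) x‖ * ‖v‖ := by
  by_cases h : u x = 0
  · rw [fderiv_dens hu]
    simp [h]
  · have hd : HasFDerivAt (fun y => ‖u y‖) (fderiv ℝ (fun y => ‖u y‖) x) x :=
      ((hu x).norm ℝ h).hasFDerivAt
    have h2 : HasFDerivAt (dens u) _ x := hd.pow 2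
    rw [h2.fderiv]
    simp only [smul_apply, smul_eq_mul]
    rw [abs_mul]
    have h3 := (fderiv ℝ (fun y => ‖u y‖) x).le_opNorm v
    rw [Real.norm_eq_abs] at h3
    have h4 : |((2 : ℕ) • ‖u x‖ ^ (2 - 1))| = 2 * ‖u x‖ := by
      simp
    calc _ ≤ |((2 : ℕ) • ‖u x‖ ^ (2 - 1))| * (‖fderiv ℝ (fun y => ‖u y‖) x‖ * ‖v‖) := by
          gcongr
      _ = _ := by rw [h4]; ring

lemma abs_fderiv_dens_le_add (hu : Differentiable ℝ u) {l : ℝ} (hl : 0 < l) (x v : Plane)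
    (hv : ‖v‖ = 1) :
    |fderiv ℝ (dens u) x v| ≤ l * dens u x + l⁻¹ * gradAbsSq u x := by
  have h := abs_fderiv_dens_le hu x v
  rw [hv, mul_one] at h
  refine h.trans ?_
  simp only [dens, gradAbsSq]
  set p := ‖u x‖
  set q := ‖fderiv ℝ (fun y => ‖u y‖) x‖
  have h2 : l * p ^ 2 + l⁻¹ * q ^ 2 - 2 * p * q = l⁻¹ * (l * p - q) ^ 2 := by
    field_simp
    ring
  have h3 : 0 ≤ l⁻¹ * (l * p - q) ^ 2 := by positivity
  linarith

lemma measurable_d0R (f : Plane → ℝ) : Measurable (d0R f) := measurable_fderiv_apply_const ℝ f e0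

lemma measurable_d1R (f : Plane → ℝ) : Measurable (d1R f) := measurable_fderiv_apply_const ℝ f e1

lemma measurable_d0 (u : Plane → ℂ) : Measurable (d0 u) := measurable_fderiv_apply_const ℝ u e0

lemma measurable_d1 (u : Plane → ℂ) : Measurable (d1 u) := measurable_fderiv_apply_const ℝ u e1

lemma measurable_momentum (hu : Continuous u) : Measurable (momentum u) := by
  have h0 := measurable_d0 u
  have h1 := measurable_d1 u
  have h2 := hu.measurable
  have h3 : Measurable fun x : Plane => x 0 := by fun_prop
  have h4 : Measurable fun x : Plane => x 1 := by fun_prop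
  have h5 : ∀ d : Plane → ℂ, Measurable d →
      Measurable fun x => ((starRingEnd ℂ) (u x) * d x).im := fun d hd =>
    Complex.measurable_im.comp ((Complex.continuous_conj.measurable.comp h2).mul hd)
  exact (h4.neg.mul (h5 _ h0)).add (h3.mul (h5 _ h1))

lemma integral_abs_fderiv_dens_le (hu : Differentiable ℝ u) (hf : Integrable (dens u))
    (hN : Integrable (gradAbsSq u)) {v : Plane} (hv : ‖v‖ = 1)
    (hN0 : 0 < ∫ x, gradAbsSq u x) (ha : 0 < ∫ x, dens u x) :
    Integrable (fun x => fderiv ℝ (dens u) x v) ∧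
      (∫ x, |fderiv ℝ (dens u) x v|) ≤
        2 * √((∫ x, dens u x) * ∫ x, gradAbsSq u x) := by
  set a := ∫ x, dens u x
  set N := ∫ x, gradAbsSq u x
  have hint : Integrable (fun x => fderiv ℝ (dens u) x v) := by
    refine ((hf.const_mul 1).add (hN.const_mul 1⁻¹)).mono'
      (measurable_fderiv_apply_const ℝ _ v).aestronglyMeasurable (ae_of_all _ fun x => ?_)
    exact abs_fderiv_dens_le_add hu one_pos x v hv
  refine ⟨hint, ?_⟩
  set l := √(N / a)
  have hl : 0 < l := Real.sqrt_pos.2 (div_pos hN0 ha)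
  calc _ ≤ ∫ x, (l * dens u x + l⁻¹ * gradAbsSq u x) :=
        integral_mono hint.abs ((hf.const_mul l).add (hN.const_mul l⁻¹))
          fun x => abs_fderiv_dens_le_add hu hl x v hv
    _ = l * a + l⁻¹ * N := by
      rw [integral_add (hf.const_mul l) (hN.const_mul l⁻¹), integral_const_mul,
        integral_const_mul]
    _ = _ := by
      have h1 : l * a = √(a * N) := by
        have : a * N = (N / a) * a ^ 2 := by field_simp
        rw [this, Real.sqrt_mul (by positivity), Real.sqrt_sq ha.le]
      have h2 : l⁻¹ * N = √(a * N) := by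
        have : a * N = (N / a)⁻¹ * N ^ 2 := by field_simp
        rw [this, Real.sqrt_mul (by positivity), Real.sqrt_sq hN0.le, Real.sqrt_inv]
      rw [h1, h2]
      ring

lemma integral_dens_sq_le (hu : Differentiable ℝ u) (hf : Integrable (dens u))
    (hN : Integrable (gradAbsSq u)) (hN0 : 0 < ∫ x, gradAbsSq u x)
    (ha : 0 < ∫ x, dens u x) :
    Integrable (fun x => dens u x ^ 2) ∧
      (∫ x, dens u x ^ 2) ≤ 4 * (∫ x, dens u x) * ∫ x, gradAbsSq u x := by
  obtain ⟨i0, h0⟩ := integral_abs_fderiv_dens_le hu hf hN norm_e0 hN0 ha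
  obtain ⟨i1, h1⟩ := integral_abs_fderiv_dens_le hu hf hN norm_e1 hN0 ha
  obtain ⟨i, h⟩ := ladyzhenskaya (differentiable_dens hu) hf i0 i1
  refine ⟨i, h.trans ((mul_le_mul h0 h1 (integral_nonneg fun _ => abs_nonneg _)
    (by positivity)).trans_eq ?_)⟩
  have := Real.mul_self_sqrt (mul_nonneg ha.le hN0.le)
  linear_combination 4 * this

/-- The pointwise diamagnetic lower bound. -/
lemma le_linDens (V : Plane → ℝ) (Ω : ℝ) (u : Plane → ℂ) (x : Plane) :
    (V x - Ω ^ 2 / 4 * ‖x‖ ^ 2) * dens u x ≤ linDens V Ω u x := by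
  have key : ∀ (b : ℝ) (z d : ℂ),
      0 ≤ ‖d‖ ^ 2 - 2 * b * ((starRingEnd ℂ) z * d).im + b ^ 2 * ‖z‖ ^ 2 := fun b z d => by
    rw [← Complex.normSq_eq_norm_sq, ← Complex.normSq_eq_norm_sq, Complex.normSq_apply,
      Complex.normSq_apply, Complex.mul_im, Complex.conj_re, Complex.conj_im]
    nlinarith [sq_nonneg (d.re + b * z.im), sq_nonneg (d.im - b * z.re)]
  have k0 := key (-(Ω / 2 * x 1)) (u x) (d0 u x)
  have k1 := key (Ω / 2 * x 0) (u x) (d1 u x)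
  simp only [linDens, gradSq, momentum, dens, norm_sq_plane]
  nlinarith [k0, k1]

lemma fderiv_ofReal_mul (hu : Differentiable ℝ u) {h : Plane → ℝ} (hh : Differentiable ℝ h)
    (x v : Plane) :
    fderiv ℝ (fun y => (h y : ℂ) * u y) x v =
      (fderiv ℝ h x v : ℂ) * u x + h x * fderiv ℝ u x v := by
  have h1 : HasFDerivAt (fun y => (h y : ℂ)) (Complex.ofRealCLM.comp (fderiv ℝ h x)) x :=
    Complex.ofRealCLM.hasFDerivAt.comp x (hh x).hasFDerivAt
  have h2 : HasFDerivAt (fun y => (h y : ℂ) * u y) _ x := h1.mul (hu x).hasFDerivAt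
  rw [h2.fderiv]
  simp
  ring

lemma dens_ofReal_mul (u : Plane → ℂ) (h : Plane → ℝ) (x : Plane) :
    dens (fun y => (h y : ℂ) * u y) x = h x ^ 2 * dens u x := by
  simp [dens, mul_pow]

lemma norm_sq_add_mul (p q : ℝ) (z d : ℂ) :
    ‖(p : ℂ) * z + q * d‖ ^ 2 =
      q ^ 2 * ‖d‖ ^ 2 + q * p * (2 * ((starRingEnd ℂ) z * d).re) + p ^ 2 * ‖z‖ ^ 2 := by
  rw [← Complex.normSq_eq_norm_sq, ← Complex.normSq_eq_norm_sq, ← Complex.normSq_eq_norm_sq]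
  simp only [Complex.normSq_apply, Complex.add_re, Complex.add_im, Complex.mul_re,
    Complex.mul_im, Complex.ofReal_re, Complex.ofReal_im, Complex.conj_re, Complex.conj_im]
  ring

lemma gradSq_ofReal_mul (hu : Differentiable ℝ u) {h : Plane → ℝ} (hh : Differentiable ℝ h)
    (x : Plane) :
    gradSq (fun y => (h y : ℂ) * u y) x = h x ^ 2 * gradSq u x
      + h x * (d0R h x * d0R (dens u) x + d1R h x * d1R (dens u) x)
      + gradSqR h x * dens u x := by
  simp only [gradSq, d0, d1, d0R, d1R, gradSqR, fderiv_ofReal_mul hu hh, norm_sq_add_mul,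
    fderiv_dens hu, dens]
  ring

lemma momentum_ofReal_mul (hu : Differentiable ℝ u) {h : Plane → ℝ} (hh : Differentiable ℝ h)
    (x : Plane) :
    momentum (fun y => (h y : ℂ) * u y) x = h x ^ 2 * momentum u x := by
  simp only [momentum, d0, d1, fderiv_ofReal_mul hu hh, map_mul, Complex.conj_ofReal,
    Complex.add_re, Complex.add_im, Complex.mul_re, Complex.mul_im, Complex.ofReal_re,
    Complex.ofReal_im, Complex.conj_re, Complex.conj_im]
  ring

end Calculus

section Trap

variable {V : Plane → ℝ} {Ω b c : ℝ} {u : Plane → ℂ}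

/-- The effective potential is nonnegative and grows at least quadratically. -/
structure Trap (V : Plane → ℝ) (Ω c b : ℝ) : Prop where
  meas : Measurable V
  nonneg : ∀ x, 0 ≤ V x - Ω ^ 2 / 4 * ‖x‖ ^ 2
  pos : 0 < c
  bound_nonneg : 0 ≤ b
  le : ∀ x, c * ‖x‖ ^ 2 ≤ V x - Ω ^ 2 / 4 * ‖x‖ ^ 2 + b

lemma exists_trap {α : ℝ} (hV : V110 V) (hΩ : 0 < Ω) (hsub : SubCritical V Ω)
    (hCV : CondV V Ω α) : ∃ c b, Trap V Ω c b := by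
  obtain ⟨W, ⟨hW, hT⟩, hΩW⟩ := hsub
  obtain ⟨R, hR⟩ := hT 0
  have hc : 0 < (W ^ 2 - Ω ^ 2) / 4 := by nlinarith
  refine ⟨(W ^ 2 - Ω ^ 2) / 4, (W ^ 2 - Ω ^ 2) / 4 * R ^ 2, hV.1, hCV.2.1, hc, by positivity,
    fun x => ?_⟩
  rcases le_total R ‖x‖ with h | h
  · have := hR x h
    have h2 : 0 ≤ (W ^ 2 - Ω ^ 2) / 4 * R ^ 2 := by positivity
    linarith
  · have := hCV.2.1 x
    have h2 : ‖x‖ ^ 2 ≤ R ^ 2 := by gcongr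
    have := mul_le_mul_of_nonneg_left h2 hc.le
    linarith

lemma continuous_dens (hu : InH1 u) : Continuous (dens u) :=
  (differentiable_dens hu.1).continuous

lemma InH1.integrable_dens (hu : InH1 u) : Integrable (dens u) := hu.2.1

lemma InH1.integrable_fderiv_dens (hu : InH1 u) {v : Plane} (hv : v = e0 ∨ v = e1) :
    Integrable (fun x => fderiv ℝ (dens u) x v) := by
  refine (hu.integrable_dens.add hu.2.2).mono'
    (measurable_fderiv_apply_const ℝ _ v).aestronglyMeasurable (ae_of_all _ fun x => ?_)
  rw [fderiv_dens hu.1, Real.norm_eq_abs, abs_mul, abs_two]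
  have h1 := Complex.abs_re_le_norm ((starRingEnd ℂ) (u x) * fderiv ℝ u x v)
  rw [norm_mul, RCLike.norm_conj] at h1
  have h2 : ‖fderiv ℝ u x v‖ ^ 2 ≤ gradSq u x := by
    rcases hv with rfl | rfl
    · exact le_add_of_nonneg_right (sq_nonneg _)
    · exact le_add_of_nonneg_left (sq_nonneg _)
  have h3 := two_mul_le_add_sq ‖u x‖ ‖fderiv ℝ u x v‖
  simp only [Pi.add_apply, dens]
  linarith

lemma InH.integrable_sq_mul (hT : Trap V Ω c b) (hu : InH V u) :
    Integrable (fun x => ‖x‖ ^ 2 * dens u x) := by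
  have hi : Integrable (fun x => c⁻¹ * (V x * dens u x + b * dens u x)) :=
    (hu.2.add (hu.1.integrable_dens.const_mul b)).const_mul c⁻¹
  have hm : Measurable fun x : Plane => ‖x‖ ^ 2 * dens u x :=
    (measurable_norm.pow_const 2).mul (continuous_dens hu.1).measurable
  refine hi.mono' hm.aestronglyMeasurable (ae_of_all _ fun x => ?_)
  have h0 := dens_nonneg u x
  rw [Real.norm_of_nonneg (by positivity), ← add_mul, ← mul_assoc]
  gcongr
  rw [le_inv_mul_iff₀ hT.pos]
  have := hT.le x
  have : 0 ≤ Ω ^ 2 / 4 * ‖x‖ ^ 2 := by positivity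
  linarith

lemma integrable_norm_mul_of_sq {f : Plane → ℝ} (hf : ∀ x, 0 ≤ f x) (hfi : Integrable f)
    (hf2 : Integrable fun x => ‖x‖ ^ 2 * f x) : Integrable (fun x => ‖x‖ * f x) := by
  refine (hfi.add hf2).mono' (continuous_norm.aestronglyMeasurable.mul
    hfi.aestronglyMeasurable) (ae_of_all _ fun x => ?_)
  rw [Real.norm_of_nonneg (mul_nonneg (norm_nonneg _) (hf x))]
  simp only [Pi.add_apply]
  have h1 := hf x
  have : ‖x‖ ≤ 1 + ‖x‖ ^ 2 := by nlinarith [sq_nonneg (‖x‖ - 1)]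
  nlinarith

lemma InH.integrable_norm_mul (hT : Trap V Ω c b) (hu : InH V u) :
    Integrable (fun x => ‖x‖ * dens u x) :=
  integrable_norm_mul_of_sq (dens_nonneg u) hu.1.integrable_dens (hu.integrable_sq_mul hT)

lemma InH.integrable_momentum (hT : Trap V Ω c b) (hu : InH V u) :
    Integrable (momentum u) := by
  refine ((hu.integrable_sq_mul hT).add hu.1.2.2).mono'
    (measurable_momentum hu.1.1.continuous).aestronglyMeasurable (ae_of_all _ fun x => ?_)
  have key : ∀ (r : ℝ) (z d : ℂ), |r * ((starRingEnd ℂ) z * d).im| ≤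
      r ^ 2 * ‖z‖ ^ 2 + ‖d‖ ^ 2 := fun r z d => by
    have h1 := Complex.abs_im_le_norm ((starRingEnd ℂ) z * d)
    rw [norm_mul, RCLike.norm_conj] at h1
    rw [abs_mul]
    have h2 := mul_le_mul_of_nonneg_left h1 (abs_nonneg r)
    have h3 := two_mul_le_add_sq (|r| * ‖z‖) ‖d‖
    rw [mul_pow, sq_abs] at h3
    nlinarith [sq_nonneg (|r| * ‖z‖), sq_nonneg ‖d‖, sq_abs r, sq_nonneg (r * ‖z‖)]
  have k0 := key (-(x 1)) (u x) (d0 u x)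
  have k1 := key (x 0) (u x) (d1 u x)
  refine (abs_add_le _ _).trans ((add_le_add k0 k1).trans (le_of_eq ?_))
  simp only [Pi.add_apply, dens, gradSq, norm_sq_plane]
  ring

lemma InH.integrable_linDens (hT : Trap V Ω c b) (hu : InH V u) : Integrable (linDens V Ω u) :=
  (hu.1.2.2.add hu.2).sub ((hu.integrable_momentum hT).const_mul Ω)

lemma Ea_eq (hT : Trap V Ω c b) (hu : InH V u) :
    Ea V Ω u = (∫ x, linDens V Ω u x) + 1 / 2 * logConv u - 1 / 2 * ∫ x, dens u x ^ 2 := by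
  have h1 : (∫ x, linDens V Ω u x) = (∫ x, (gradSq u x + V x * ‖u x‖ ^ 2)) -
      Ω * ∫ x, momentum u x := by
    rw [← integral_const_mul]
    exact integral_sub (hu.1.2.2.add hu.2) ((hu.integrable_momentum hT).const_mul Ω)
  have h2 : ∀ x, dens u x ^ 2 = ‖u x‖ ^ 4 := fun x => by
    rw [dens, ← pow_mul]
  rw [Ea, h1]
  simp_rw [h2]
  ring

lemma Trap.le_integral_linDens (hT : Trap V Ω c b) (hu : InH V u) :
    c * (∫ x, ‖x‖ ^ 2 * dens u x) ≤ (∫ x, linDens V Ω u x) + b * ∫ x, dens u x := by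
  rw [← integral_const_mul, ← integral_const_mul,
    ← integral_add (hu.integrable_linDens hT) (hu.1.integrable_dens.const_mul b)]
  refine integral_mono ((hu.integrable_sq_mul hT).const_mul c)
    ((hu.integrable_linDens hT).add (hu.1.integrable_dens.const_mul b)) fun x => ?_
  have h1 := le_linDens V Ω u x
  have h2 := mul_le_mul_of_nonneg_right (hT.le x) (dens_nonneg u x)
  linarith

end Trap

section LogEnergy

variable {α : ℝ} {f g₁ g₂ : Plane → ℝ}

/-- The bilinear form with logarithmic kernel. -/
def logForm (f g : Plane → ℝ) : ℝ :=
  ∫ z : Plane × Plane, Real.log ‖z.1 - z.2‖ * f z.1 * g z.2 ∂volume.prod volume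

lemma logForm_comm (f g : Plane → ℝ) : logForm f g = logForm g f := by
  rw [logForm, ← integral_prod_swap]
  refine integral_congr_ae (ae_of_all _ fun z => ?_)
  simp only [Prod.fst_swap, Prod.snd_swap, norm_sub_rev z.2]
  ring

lemma integrable_prod_log_of_abs_le (hα : 0 < α) (hα1 : α < 1) (hf : ∀ x, 0 ≤ f x)
    (hfi : Integrable f) (hf2 : Integrable fun y => f y ^ 2)
    (hfm : Integrable fun y => ‖y‖ * f y) (h1 : Measurable g₁) (h2 : Measurable g₂)
    (hb1 : ∀ x, |g₁ x| ≤ f x) (hb2 : ∀ x, |g₂ x| ≤ f x) :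
    Integrable (fun z : Plane × Plane => Real.log ‖z.1 - z.2‖ * g₁ z.1 * g₂ z.2)
      (volume.prod volume) := by
  refine (integrable_prod_log_mul hα hα1 hf hfi hf2 hfm).mono (Measurable.aestronglyMeasurable
    (((Real.measurable_log.comp (measurable_fst.sub measurable_snd).norm).mul
      (h1.comp measurable_fst)).mul (h2.comp measurable_snd))) (ae_of_all _ fun z => ?_)
  simp only [norm_mul, Real.norm_eq_abs, abs_of_nonneg (hf _)]
  have := hb1 z.1
  have := hb2 z.2
  gcongr
  exact mul_nonneg (abs_nonneg _) (hf _)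

lemma logForm_eq_integral_integral (hα : 0 < α) (hα1 : α < 1) (hf : ∀ x, 0 ≤ f x)
    (hfi : Integrable f) (hf2 : Integrable fun y => f y ^ 2)
    (hfm : Integrable fun y => ‖y‖ * f y) (h1 : Measurable g₁) (h2 : Measurable g₂)
    (hb1 : ∀ x, |g₁ x| ≤ f x) (hb2 : ∀ x, |g₂ x| ≤ f x) :
    logForm g₁ g₂ = ∫ x, ∫ y, Real.log ‖x - y‖ * g₁ x * g₂ y :=
  integral_prod _ (integrable_prod_log_of_abs_le hα hα1 hf hfi hf2 hfm h1 h2 hb1 hb2)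

lemma le_logForm (hα : 0 < α) (hα1 : α < 1) (hf : ∀ x, 0 ≤ f x) (hfM : Measurable f)
    (hfi : Integrable f) (hf2 : Integrable fun y => f y ^ 2)
    (hfm : Integrable fun y => ‖y‖ * f y) (h1 : Measurable g₁) (h0 : ∀ x, 0 ≤ g₁ x)
    (hb1 : ∀ x, g₁ x ≤ f x) :
    -(α⁻¹ * rieszC α f) * (∫ x, g₁ x) ≤ logForm g₁ f := by
  have hb1' : ∀ x, |g₁ x| ≤ f x := fun x => (abs_of_nonneg (h0 x)).trans_le (hb1 x)
  have hb2' : ∀ x, |f x| ≤ f x := fun x => (abs_of_nonneg (hf x)).le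
  have hI := integrable_prod_log_of_abs_le hα hα1 hf hfi hf2 hfm h1 hfM hb1' hb2'
  rw [logForm_eq_integral_integral hα hα1 hf hfi hf2 hfm h1 hfM hb1' hb2', ← integral_const_mul]
  refine integral_mono ((hfi.mono' h1.aestronglyMeasurable (ae_of_all _ hb1')).const_mul _)
    hI.integral_prod_left fun x => ?_
  have h3 : ∫ y, Real.log ‖x - y‖ * g₁ x * f y = g₁ x * ∫ y, Real.log ‖x - y‖ * f y := by
    rw [← integral_const_mul]
    congr 1
    ext y
    ring
  have h4 := mul_le_mul_of_nonneg_left (le_integral_log_mul hα hα1 hf hfi hf2 hfm x) (h0 x)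
  simp only at h3 ⊢
  rw [h3]
  linarith

lemma logForm_self_le (hα : 0 < α) (hα1 : α < 1) (hf : ∀ x, 0 ≤ f x)
    (hfi : Integrable f) (hf2 : Integrable fun y => f y ^ 2)
    (hfm : Integrable fun y => ‖y‖ * f y) :
    logForm f f ≤ 2 * (∫ x, f x) * ∫ x, ‖x‖ * f x := by
  have hA := hfm.mul_prod hfi
  have hB := hfi.mul_prod hfm
  have key : logForm f f ≤ ∫ z : Plane × Plane,
      ((‖z.1‖ * f z.1) * f z.2 + f z.1 * (‖z.2‖ * f z.2)) ∂volume.prod volume := by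
    refine integral_mono (integrable_prod_log_mul hα hα1 hf hfi hf2 hfm) (hA.add hB) fun z => ?_
    have h1 : Real.log ‖z.1 - z.2‖ ≤ ‖z.1‖ + ‖z.2‖ :=
      (Real.log_le_self (norm_nonneg _)).trans (norm_sub_le _ _)
    have h2 := mul_le_mul_of_nonneg_right h1 (mul_nonneg (hf z.1) (hf z.2))
    simp only
    linarith
  refine key.trans_eq ?_
  rw [integral_add hA hB, integral_prod_mul (fun x => ‖x‖ * f x) f,
    integral_prod_mul f fun x => ‖x‖ * f x]
  ring

end LogEnergy

lemma eq_of_le_rational {a m P0 P1 P2 R0 R1 R2 : ℝ} (ha : 0 < a)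
    (h : ∀ t, |t| ≤ 1 / 2 → P0 + R0 ≤ a / (a - t * m) * (P0 - t * P1 + t ^ 2 * P2) +
      (a / (a - t * m)) ^ 2 * (R0 - t * R1 + t ^ 2 * R2)) :
    P1 + R1 = m / a * (P0 + 2 * R0) := by
  set F : ℝ → ℝ := fun t => a / (a - t * m) * (P0 - t * P1 + t ^ 2 * P2) +
      (a / (a - t * m)) ^ 2 * (R0 - t * R1 + t ^ 2 * R2)
  have hs : HasDerivAt (fun t => a / (a - t * m)) (m / a) 0 := by
    have h1 : HasDerivAt (fun t => a - t * m) (-(1 * m)) 0 :=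
      ((hasDerivAt_id (0 : ℝ)).mul_const m).const_sub a
    have h2 := (hasDerivAt_const (0 : ℝ) a).fun_div h1 (by simpa using ha.ne')
    refine h2.congr_deriv ?_
    simp
    field_simp
  have hq : ∀ A B C : ℝ, HasDerivAt (fun t : ℝ => A - t * B + t ^ 2 * C) (-B) 0 := fun A B C => by
    have h1 := (((hasDerivAt_id (0 : ℝ)).mul_const B).const_sub A).fun_add
      (((hasDerivAt_id (0 : ℝ)).fun_pow 2).mul_const C)
    refine h1.congr_deriv ?_
    simp
  have hF := (hs.fun_mul (hq P0 P1 P2)).fun_add ((hs.fun_pow 2).fun_mul (hq R0 R1 R2))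
  have hmin : IsLocalMin F 0 := by
    filter_upwards [Metric.closedBall_mem_nhds (0 : ℝ) (by norm_num : (0 : ℝ) < 1 / 2)] with t ht
    have h0 : F 0 = P0 + R0 := by
      simp [F, ha.ne']
    rw [h0]
    exact h t (by simpa using ht)
  have hz := hmin.hasDerivAt_eq_zero hF
  have e1 : a / (a - 0 * m) = 1 := by simp [ha.ne']
  rw [e1] at hz
  simp at hz
  linarith

section Perturb

variable {V : Plane → ℝ} {Ω σ : ℝ} {u : Plane → ℂ} {q : Plane → ℝ}

/-- Multiplication of the density of `u` by `σ * q`. -/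
def reweight (σ : ℝ) (q : Plane → ℝ) (u : Plane → ℂ) (x : Plane) : ℂ :=
  ((√(σ * q x) : ℝ) : ℂ) * u x

lemma hasFDerivAt_sqrt_mul (hσ : 0 < σ) (hq : Differentiable ℝ q) (hq0 : ∀ x, 0 < q x)
    (x : Plane) : HasFDerivAt (fun y => √(σ * q y))
      ((1 / (2 * √(σ * q x))) • σ • fderiv ℝ q x) x :=
  ((hq x).hasFDerivAt.const_mul σ).sqrt (mul_pos hσ (hq0 x)).ne'

lemma differentiable_sqrt_mul (hσ : 0 < σ) (hq : Differentiable ℝ q) (hq0 : ∀ x, 0 < q x) :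
    Differentiable ℝ (fun y => √(σ * q y)) :=
  fun x => (hasFDerivAt_sqrt_mul hσ hq hq0 x).differentiableAt

lemma differentiable_reweight (hu : Differentiable ℝ u) (hσ : 0 < σ) (hq : Differentiable ℝ q)
    (hq0 : ∀ x, 0 < q x) : Differentiable ℝ (reweight σ q u) :=
  (Complex.ofRealCLM.differentiable.comp (differentiable_sqrt_mul hσ hq hq0)).mul hu

lemma dens_reweight (hσ : 0 < σ) (hq0 : ∀ x, 0 < q x) (x : Plane) :
    dens (reweight σ q u) x = σ * (q x * dens u x) := by
  rw [← mul_assoc, ← Real.sq_sqrt (mul_pos hσ (hq0 x)).le]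
  exact dens_ofReal_mul u _ x

lemma sqrt_mul_fderiv (hσ : 0 < σ) (hq : Differentiable ℝ q) (hq0 : ∀ x, 0 < q x)
    (x v : Plane) : √(σ * q x) * fderiv ℝ (fun y => √(σ * q y)) x v = σ / 2 * fderiv ℝ q x v := by
  have h := Real.sqrt_pos.2 (mul_pos hσ (hq0 x))
  rw [(hasFDerivAt_sqrt_mul hσ hq hq0 x).fderiv]
  simp only [smul_apply, smul_eq_mul]
  field_simp

lemma fderiv_sqrt_mul_sq (hσ : 0 < σ) (hq : Differentiable ℝ q) (hq0 : ∀ x, 0 < q x)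
    (x v : Plane) : fderiv ℝ (fun y => √(σ * q y)) x v ^ 2 =
      σ * (fderiv ℝ q x v ^ 2 / (4 * q x)) := by
  have h := hq0 x
  have h2 := Real.sq_sqrt (mul_pos hσ h).le
  have h3 := sqrt_mul_fderiv hσ hq hq0 x v
  set s := √(σ * q x)
  set d := fderiv ℝ (fun y => √(σ * q y)) x v
  have h4 : σ * q x * d ^ 2 = σ ^ 2 / 4 * fderiv ℝ q x v ^ 2 := by
    rw [← h2, ← mul_pow, h3]
    ring
  field_simp
  refine mul_left_cancel₀ hσ.ne' ?_
  linear_combination 4 * h4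

lemma gradSq_reweight (hu : Differentiable ℝ u) (hσ : 0 < σ) (hq : Differentiable ℝ q)
    (hq0 : ∀ x, 0 < q x) (x : Plane) :
    gradSq (reweight σ q u) x = σ * (q x * gradSq u x
      + 1 / 2 * (d0R q x * d0R (dens u) x + d1R q x * d1R (dens u) x)
      + gradSqR q x / (4 * q x) * dens u x) := by
  refine (gradSq_ofReal_mul hu (differentiable_sqrt_mul hσ hq hq0) x).trans ?_
  have h0 := sqrt_mul_fderiv hσ hq hq0 x e0
  have h1 := sqrt_mul_fderiv hσ hq hq0 x e1
  have h2 := fderiv_sqrt_mul_sq hσ hq hq0 x e0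
  have h3 := fderiv_sqrt_mul_sq hσ hq hq0 x e1
  rw [Real.sq_sqrt (mul_pos hσ (hq0 x)).le]
  simp only [gradSqR, d0R, d1R]
  rw [h2, h3]
  linear_combination (fderiv ℝ (dens u) x e0) * h0 + (fderiv ℝ (dens u) x e1) * h1

lemma linDens_reweight (hu : Differentiable ℝ u) (hσ : 0 < σ) (hq : Differentiable ℝ q)
    (hq0 : ∀ x, 0 < q x) (x : Plane) :
    linDens V Ω (reweight σ q u) x = σ * (q x * linDens V Ω u x
      + 1 / 2 * (d0R q x * d0R (dens u) x + d1R q x * d1R (dens u) x)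
      + gradSqR q x / (4 * q x) * dens u x) := by
  have hm : momentum (reweight σ q u) x = σ * q x * momentum u x := by
    refine (momentum_ofReal_mul hu (differentiable_sqrt_mul hσ hq hq0) x).trans ?_
    rw [Real.sq_sqrt (mul_pos hσ (hq0 x)).le]
  rw [linDens, gradSq_reweight hu hσ hq hq0, dens_reweight hσ hq0, hm, linDens]
  ring

end Perturb

section FirstVariation

variable {V : Plane → ℝ} {Ω b c α L t : ℝ} {u : Plane → ℂ} {η : Plane → ℝ}

/-- Cutoff functions with values in `[0, 1]` and bounded gradient. -/
structure Cutoff (η : Plane → ℝ) (L : ℝ) : Prop where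
  diff : Differentiable ℝ η
  nonneg : ∀ x, 0 ≤ η x
  le_one : ∀ x, η x ≤ 1
  bound0 : ∀ x, |d0R η x| ≤ L
  bound1 : ∀ x, |d1R η x| ≤ L

lemma Cutoff.half_le (hη : Cutoff η L) (ht : |t| ≤ 1 / 2) (x : Plane) : 1 / 2 ≤ 1 - t * η x := by
  have h0 := hη.nonneg x
  have h1 := hη.le_one x
  have h2 := le_abs_self t
  nlinarith

lemma Cutoff.le_two (hη : Cutoff η L) (ht : |t| ≤ 1 / 2) (x : Plane) : 1 - t * η x ≤ 2 := by
  have h0 := hη.nonneg x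
  have h1 := hη.le_one x
  have h2 := neg_abs_le t
  nlinarith

lemma Cutoff.fderiv_eq (hη : Cutoff η L) (x v : Plane) :
    fderiv ℝ (fun y => 1 - t * η y) x v = -(t * fderiv ℝ η x v) := by
  rw [(((hη.diff x).hasFDerivAt.const_mul t).const_sub 1).fderiv]
  simp

lemma Cutoff.integrable_mul (hη : Cutoff η L) {f : Plane → ℝ} (hf : Integrable f) :
    Integrable (fun x => η x * f x) :=
  hf.bdd_mul (c := 1) hη.diff.continuous.aestronglyMeasurable (ae_of_all _ fun x => by
    rw [Real.norm_of_nonneg (hη.nonneg x)]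
    exact hη.le_one x)

lemma Cutoff.integrable_grad_mul (hη : Cutoff η L) (hu : InH1 u) :
    Integrable (fun x => d0R η x * d0R (dens u) x + d1R η x * d1R (dens u) x) :=
  ((hu.integrable_fderiv_dens (Or.inl rfl)).bdd_mul (c := L)
    (measurable_d0R η).aestronglyMeasurable (ae_of_all _ hη.bound0)).add
  ((hu.integrable_fderiv_dens (Or.inr rfl)).bdd_mul (c := L)
    (measurable_d1R η).aestronglyMeasurable (ae_of_all _ hη.bound1))

lemma Cutoff.gradSqR_div_le (hη : Cutoff η L) (ht : |t| ≤ 1 / 2) (x : Plane) :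
    0 ≤ gradSqR (fun y => 1 - t * η y) x / (4 * (1 - t * η x)) ∧
    gradSqR (fun y => 1 - t * η y) x / (4 * (1 - t * η x)) ≤ t ^ 2 * L ^ 2 := by
  have h1 := hη.half_le ht x
  have h2 : d0R η x ^ 2 ≤ L ^ 2 := by
    rw [← sq_abs]
    have := hη.bound0 x
    gcongr
  have h3 : d1R η x ^ 2 ≤ L ^ 2 := by
    rw [← sq_abs]
    have := hη.bound1 x
    gcongr
  have h4 : gradSqR (fun y => 1 - t * η y) x = t ^ 2 * (d0R η x ^ 2 + d1R η x ^ 2) := by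
    simp only [gradSqR, d0R, d1R, hη.fderiv_eq]
    ring
  rw [h4]
  refine ⟨by positivity, ?_⟩
  rw [div_le_iff₀ (by linarith)]
  have h5 : t ^ 2 * L ^ 2 * 2 ≤ t ^ 2 * L ^ 2 * (4 * (1 - t * η x)) := by
    gcongr
    linarith
  have h6 : t ^ 2 * (d0R η x ^ 2 + d1R η x ^ 2) ≤ t ^ 2 * (L ^ 2 + L ^ 2) := by gcongr
  linarith

lemma Cutoff.integrable_gradSqR_div (hη : Cutoff η L) (hu : InH1 u) (ht : |t| ≤ 1 / 2) :
    Integrable (fun x =>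
      gradSqR (fun y => 1 - t * η y) x / (4 * (1 - t * η x)) * dens u x) := by
  refine hu.integrable_dens.bdd_mul (c := t ^ 2 * L ^ 2) (Measurable.aestronglyMeasurable ?_)
    (ae_of_all _ fun x => ?_)
  · have := hη.diff.continuous.measurable
    exact (((measurable_d0R _).pow_const 2).add ((measurable_d1R _).pow_const 2)).div
      (((this.const_mul t).const_sub 1).const_mul 4)
  · obtain ⟨h1, h2⟩ := hη.gradSqR_div_le ht x
    rwa [Real.norm_of_nonneg h1]

lemma Cutoff.integral_mul_le (hη : Cutoff η L) (hu : InH1 u) :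
    ∫ x, η x * dens u x ≤ ∫ x, dens u x :=
  integral_mono (hη.integrable_mul hu.integrable_dens) hu.integrable_dens fun x =>
    mul_le_of_le_one_left (dens_nonneg u x) (hη.le_one x)

lemma Cutoff.integral_mul_nonneg (hη : Cutoff η L) (u : Plane → ℂ) :
    0 ≤ ∫ x, η x * dens u x :=
  integral_nonneg fun x => mul_nonneg (hη.nonneg x) (dens_nonneg u x)

lemma InH.reweight (hη : Cutoff η L) (hu : InH V u) (ht : |t| ≤ 1 / 2) {σ : ℝ} (hσ : 0 < σ) :
    InH V (reweight σ (fun x => 1 - t * η x) u) := by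
  have hq : Differentiable ℝ fun x => 1 - t * η x := (hη.diff.const_mul t).const_sub 1
  have hq0 : ∀ x, 0 < 1 - t * η x := fun x => by linarith [hη.half_le ht x]
  have hb : ∀ f : Plane → ℝ, Integrable f → Integrable fun x => (1 - t * η x) * f x :=
    fun f hf => hf.bdd_mul (c := 2) hq.continuous.aestronglyMeasurable (ae_of_all _ fun x => by
      rw [Real.norm_of_nonneg (hq0 x).le]
      exact hη.le_two ht x)
  refine ⟨⟨differentiable_reweight hu.1.1 hσ hq hq0, ?_, ?_⟩, ?_⟩
  · refine ((hb _ hu.1.integrable_dens).const_mul σ).congr (ae_of_all _ fun x => ?_)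
    exact (dens_reweight hσ hq0 x).symm
  · rw [funext (gradSq_reweight hu.1.1 hσ hq hq0)]
    refine Integrable.const_mul (Integrable.add (Integrable.add (hb _ hu.1.2.2)
      (Integrable.const_mul ?_ _)) (hη.integrable_gradSqR_div hu.1 ht)) σ
    refine (hη.integrable_grad_mul hu.1).const_mul (-t) |>.congr (ae_of_all _ fun x => ?_)
    simp only [d0R, d1R, hη.fderiv_eq]
    ring
  · refine ((hb _ hu.2).const_mul σ).congr (ae_of_all _ fun x => ?_)
    have : ‖_root_.reweight σ (fun x => 1 - t * η x) u x‖ ^ 2 = _ := dens_reweight hσ hq0 x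
    simp only [this]
    simp only [dens]
    ring

lemma integral_linDens_reweight_le (hT : Trap V Ω c b) (hη : Cutoff η L) (hu : InH V u)
    (ht : |t| ≤ 1 / 2) {σ : ℝ} (hσ : 0 < σ) :
    ∫ x, linDens V Ω (reweight σ (fun x => 1 - t * η x) u) x ≤
      σ * ((∫ x, linDens V Ω u x) - t * ((∫ x, η x * linDens V Ω u x)
        + 1 / 2 * ∫ x, (d0R η x * d0R (dens u) x + d1R η x * d1R (dens u) x))
        + t ^ 2 * (L ^ 2 * ∫ x, dens u x)) := by
  have hq : Differentiable ℝ fun x => 1 - t * η x := (hη.diff.const_mul t).const_sub 1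
  have hq0 : ∀ x, 0 < 1 - t * η x := fun x => by linarith [hη.half_le ht x]
  have i1 := hu.integrable_linDens hT
  have i2 := hη.integrable_mul i1
  have i3 := hη.integrable_grad_mul hu.1
  have i4 := hu.1.integrable_dens
  have j1 : Integrable fun x => t * (η x * linDens V Ω u x) := i2.const_mul t
  have j2 : Integrable fun x => t / 2 * (d0R η x * d0R (dens u) x + d1R η x * d1R (dens u) x) :=
    i3.const_mul _
  have j3 : Integrable fun x => t ^ 2 * L ^ 2 * dens u x := i4.const_mul _
  have k1 : Integrable fun x => linDens V Ω u x - t * (η x * linDens V Ω u x) := i1.sub j1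
  have k2 : Integrable fun x => linDens V Ω u x - t * (η x * linDens V Ω u x)
      - t / 2 * (d0R η x * d0R (dens u) x + d1R η x * d1R (dens u) x) := k1.sub j2
  have key : ∫ x, linDens V Ω (reweight σ (fun x => 1 - t * η x) u) x ≤
      ∫ x, σ * (linDens V Ω u x - t * (η x * linDens V Ω u x)
      - t / 2 * (d0R η x * d0R (dens u) x + d1R η x * d1R (dens u) x)
      + t ^ 2 * L ^ 2 * dens u x) := by
    refine integral_mono ((hu.reweight hη ht hσ).integrable_linDens hT)
      ((k2.add j3).const_mul σ) fun x => ?_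
    simp only
    rw [linDens_reweight hu.1.1 hσ hq hq0]
    refine mul_le_mul_of_nonneg_left ?_ hσ.le
    have h1 := mul_le_mul_of_nonneg_right (hη.gradSqR_div_le ht x).2 (dens_nonneg u x)
    simp only [d0R, d1R, hη.fderiv_eq] at h1 ⊢
    linarith
  refine key.trans_eq ?_
  rw [integral_const_mul, integral_add k2 j3, integral_sub k1 j2, integral_sub i1 j1,
    integral_const_mul, integral_const_mul, integral_const_mul]
  ring

lemma integral_dens_sq_reweight (hη : Cutoff η L)
    (hf2 : Integrable fun x => dens u x ^ 2) (ht : |t| ≤ 1 / 2) {σ : ℝ} (hσ : 0 < σ) :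
    ∫ x, dens (reweight σ (fun x => 1 - t * η x) u) x ^ 2 =
      σ ^ 2 * ((∫ x, dens u x ^ 2) - t * (2 * ∫ x, η x * dens u x ^ 2)
        + t ^ 2 * ∫ x, η x * (η x * dens u x ^ 2)) := by
  have hq0 : ∀ x, 0 < 1 - t * η x := fun x => by linarith [hη.half_le ht x]
  have i1 := hη.integrable_mul hf2
  have i2 := hη.integrable_mul i1
  have j1 : Integrable fun x => 2 * t * (η x * dens u x ^ 2) := i1.const_mul _
  have j2 : Integrable fun x => t ^ 2 * (η x * (η x * dens u x ^ 2)) := i2.const_mul _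
  have k1 : Integrable fun x => dens u x ^ 2 - 2 * t * (η x * dens u x ^ 2) := hf2.sub j1
  have : ∀ x, dens (reweight σ (fun x => 1 - t * η x) u) x ^ 2 =
      σ ^ 2 * (dens u x ^ 2 - 2 * t * (η x * dens u x ^ 2)
        + t ^ 2 * (η x * (η x * dens u x ^ 2))) := fun x => by
    rw [dens_reweight hσ hq0]
    ring
  simp_rw [this]
  rw [integral_const_mul, integral_add k1 j2, integral_sub hf2 j1, integral_const_mul,
    integral_const_mul]
  ring

lemma logConv_eq_logForm (hα : 0 < α) (hα1 : α < 1) (hu : InH1 u)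
    (hf2 : Integrable fun y => dens u y ^ 2)
    (hfm : Integrable fun y => ‖y‖ * dens u y) : logConv u = logForm (dens u) (dens u) := by
  have hb : ∀ x, |dens u x| ≤ dens u x := fun x => (abs_of_nonneg (dens_nonneg u x)).le
  have hM := (continuous_dens hu).measurable
  exact (logForm_eq_integral_integral hα hα1 (dens_nonneg u) hu.integrable_dens hf2 hfm hM hM
    hb hb).symm

lemma integral_sub_sub_add {X : Type*} [MeasurableSpace X] {μ : Measure X}
    {f₀ f₁ f₂ f₃ : X → ℝ} (h₀ : Integrable f₀ μ) (h₁ : Integrable f₁ μ) (h₂ : Integrable f₂ μ)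
    (h₃ : Integrable f₃ μ) (s t : ℝ) :
    ∫ x, (f₀ x - t * f₁ x - t * f₂ x + s * f₃ x) ∂μ =
      (∫ x, f₀ x ∂μ) - t * (∫ x, f₁ x ∂μ) - t * (∫ x, f₂ x ∂μ) + s * ∫ x, f₃ x ∂μ := by
  have j1 : Integrable (fun x => f₀ x - t * f₁ x) μ := h₀.sub (h₁.const_mul t)
  have j2 : Integrable (fun x => f₀ x - t * f₁ x - t * f₂ x) μ := j1.sub (h₂.const_mul t)
  rw [integral_add j2 (h₃.const_mul s), integral_sub j1 (h₂.const_mul t),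
    integral_sub h₀ (h₁.const_mul t), integral_const_mul, integral_const_mul, integral_const_mul]

lemma logConv_reweight (hα : 0 < α) (hα1 : α < 1) (hη : Cutoff η L) (hu : InH1 u)
    (hf2 : Integrable fun y => dens u y ^ 2)
    (hfm : Integrable fun y => ‖y‖ * dens u y) (ht : |t| ≤ 1 / 2) {σ : ℝ} (hσ : 0 < σ) :
    logConv (reweight σ (fun x => 1 - t * η x) u) =
      σ ^ 2 * (logForm (dens u) (dens u)
        - t * (2 * logForm (fun x => η x * dens u x) (dens u))
        + t ^ 2 * logForm (fun x => η x * dens u x) (fun x => η x * dens u x)) := by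
  have hq0 : ∀ x, 0 < 1 - t * η x := fun x => by linarith [hη.half_le ht x]
  have hf := dens_nonneg u
  have hfi := hu.integrable_dens
  have hM := (continuous_dens hu).measurable
  have hηM : Measurable fun x => η x * dens u x := hη.diff.continuous.measurable.mul hM
  have hb : ∀ x, |dens u x| ≤ dens u x := fun x => (abs_of_nonneg (hf x)).le
  have hηb : ∀ x, |η x * dens u x| ≤ dens u x := fun x => by
    rw [abs_of_nonneg (mul_nonneg (hη.nonneg x) (hf x))]
    exact mul_le_of_le_one_left (hf x) (hη.le_one x)
  have i0 := integrable_prod_log_of_abs_le hα hα1 hf hfi hf2 hfm hM hM hb hb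
  have i1 := integrable_prod_log_of_abs_le hα hα1 hf hfi hf2 hfm hηM hM hηb hb
  have i2 := integrable_prod_log_of_abs_le hα hα1 hf hfi hf2 hfm hM hηM hb hηb
  have i3 := integrable_prod_log_of_abs_le hα hα1 hf hfi hf2 hfm hηM hηM hηb hηb
  have h2f : Integrable fun x => 2 * dens u x := hfi.const_mul 2
  have hgM : Measurable fun x => (1 - t * η x) * dens u x :=
    ((hη.diff.continuous.measurable.const_mul t).const_sub 1).mul hM
  have hgb : ∀ x, |(1 - t * η x) * dens u x| ≤ 2 * dens u x := fun x => by
    rw [abs_of_nonneg (mul_nonneg (hq0 x).le (hf x))]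
    exact mul_le_mul_of_nonneg_right (hη.le_two ht x) (hf x)
  have h1 : logConv (reweight σ (fun x => 1 - t * η x) u) =
      σ ^ 2 * ∫ x, ∫ y, Real.log ‖x - y‖ * ((1 - t * η x) * dens u x) *
        ((1 - t * η y) * dens u y) := by
    rw [← integral_const_mul]
    refine integral_congr_ae (ae_of_all _ fun x => ?_)
    simp only
    rw [← integral_const_mul]
    refine integral_congr_ae (ae_of_all _ fun y => ?_)
    have e1 : ‖reweight σ (fun x => 1 - t * η x) u x‖ ^ 2 = _ := dens_reweight hσ hq0 x
    have e2 : ‖reweight σ (fun x => 1 - t * η x) u y‖ ^ 2 = _ := dens_reweight hσ hq0 y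
    simp only [e1, e2]
    ring
  rw [h1, ← logForm_eq_integral_integral hα hα1 (fun x => mul_nonneg zero_le_two (hf x)) h2f
    ((hf2.const_mul 4).congr (ae_of_all _ fun x => by ring))
    ((hfm.const_mul 2).congr (ae_of_all _ fun x => by ring)) hgM hgM hgb hgb]
  congr 1
  have h2 : ∀ z : Plane × Plane, Real.log ‖z.1 - z.2‖ * ((1 - t * η z.1) * dens u z.1) *
      ((1 - t * η z.2) * dens u z.2) =
      Real.log ‖z.1 - z.2‖ * dens u z.1 * dens u z.2
      - t * (Real.log ‖z.1 - z.2‖ * (η z.1 * dens u z.1) * dens u z.2)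
      - t * (Real.log ‖z.1 - z.2‖ * dens u z.1 * (η z.2 * dens u z.2))
      + t ^ 2 * (Real.log ‖z.1 - z.2‖ * (η z.1 * dens u z.1) * (η z.2 * dens u z.2)) :=
    fun z => by ring
  have h3 := logForm_comm (dens u) fun x => η x * dens u x
  unfold logForm at h3 ⊢
  simp_rw [h2]
  rw [integral_sub_sub_add i0 i1 i2 i3, h3]
  ring

/-- The Euler–Lagrange equation tested against `η u`, real part. -/
lemma first_variation (hα : 0 < α) (hα1 : α < 1) (hT : Trap V Ω c b) (hη : Cutoff η L) {a : ℝ}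
    (ha : 0 < a) (hmin : IsMinimizer V Ω a u) (hf2 : Integrable fun y => dens u y ^ 2) :
    ((∫ x, η x * linDens V Ω u x)
        + 1 / 2 * ∫ x, (d0R η x * d0R (dens u) x + d1R η x * d1R (dens u) x))
      + (logForm (fun x => η x * dens u x) (dens u) - ∫ x, η x * dens u x ^ 2) =
    (∫ x, η x * dens u x) / a * ((∫ x, linDens V Ω u x)
      + 2 * (1 / 2 * logForm (dens u) (dens u) - 1 / 2 * ∫ x, dens u x ^ 2)) := by
  obtain ⟨⟨hu, hua⟩, hle⟩ := hmin
  have hua' : ∫ x, dens u x = a := hua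
  have hfm := hu.integrable_norm_mul hT
  have hm1 := hη.integral_mul_le hu.1
  have hm0 := hη.integral_mul_nonneg u
  rw [hua'] at hm1
  set m := ∫ x, η x * dens u x
  refine eq_of_le_rational (P2 := L ^ 2 * ∫ x, dens u x)
    (R2 := 1 / 2 * logForm (fun x => η x * dens u x) (fun x => η x * dens u x)
      - 1 / 2 * ∫ x, η x * (η x * dens u x ^ 2)) ha fun t ht => ?_
  have hq0 : ∀ x, 0 < 1 - t * η x := fun x => by linarith [hη.half_le ht x]
  have hden : 0 < a - t * m := by
    have h2 := le_abs_self t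
    nlinarith
  have hσ : 0 < a / (a - t * m) := div_pos ha hden
  have hv := hu.reweight hη ht hσ
  set σ := a / (a - t * m)
  have hmass : ∫ x, dens (reweight σ (fun x => 1 - t * η x) u) x = a := by
    have : ∀ x, dens (reweight σ (fun x => 1 - t * η x) u) x =
        σ * (dens u x - t * (η x * dens u x)) := fun x => by
      rw [dens_reweight hσ hq0]
      ring
    simp_rw [this]
    rw [integral_const_mul, integral_sub hu.1.integrable_dens
      ((hη.integrable_mul hu.1.integrable_dens).const_mul t), integral_const_mul, hua']
    exact div_mul_cancel₀ a hden.ne'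
  have h1 := hle _ ⟨hv, hmass⟩
  rw [Ea_eq hT hu, Ea_eq hT hv, logConv_reweight hα hα1 hη hu.1 hf2 hfm ht hσ,
    integral_dens_sq_reweight hη hf2 ht hσ, logConv_eq_logForm hα hα1 hu.1 hf2 hfm] at h1
  have h2 := integral_linDens_reweight_le hT hη hu ht hσ
  linarith

end FirstVariation

section Bounds

variable {V : Plane → ℝ} {Ω b c α : ℝ} {u : Plane → ℂ}

lemma cutoff_zero : Cutoff (fun _ => 0) 0 :=
  ⟨differentiable_const 0, fun _ => le_rfl, fun _ => zero_le_one, fun x => by simp [d0R],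
    fun x => by simp [d1R]⟩

lemma hasCompactSupport_norm_sq (hc : HasCompactSupport u) :
    HasCompactSupport fun x => ‖u x‖ ^ 2 :=
  hc.comp_left (g := fun z => ‖z‖ ^ 2) (by simp)

lemma inH_of_compactSupport (hV : V110 V) (hu : ContDiff ℝ 1 u) (hc : HasCompactSupport u) :
    InH V u := by
  have hcont : Continuous fun x => ‖u x‖ ^ 2 := hu.continuous.norm.pow 2
  have hi : Integrable fun x => ‖u x‖ ^ 2 :=
    hcont.integrable_of_hasCompactSupport (hasCompactSupport_norm_sq hc)
  have hd : ∀ v, Integrable fun x => ‖fderiv ℝ u x v‖ ^ 2 := fun v => by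
    have h1 : HasCompactSupport fun x => ‖fderiv ℝ u x v‖ ^ 2 :=
      hasCompactSupport_norm_sq (hc.fderiv_apply ℝ v)
    have h2 : Continuous fun x => fderiv ℝ u x v :=
      (hu.continuous_fderiv one_ne_zero).clm_apply continuous_const
    have h3 : Continuous fun x => ‖fderiv ℝ u x v‖ ^ 2 := h2.norm.pow 2
    exact h3.integrable_of_hasCompactSupport h1
  have hg : Integrable (gradSq u) := (hd e0).add (hd e1)
  refine ⟨⟨hu.differentiable one_ne_zero, hi, hg⟩, ?_⟩
  obtain ⟨R, hR⟩ := hc.isCompact.isBounded.subset_closedBall (0 : Plane)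
  obtain ⟨C, hC⟩ := hV.2.2.1 R
  refine (hi.const_mul C).mono' (hV.1.mul hcont.measurable).aestronglyMeasurable
    (ae_of_all _ fun x => ?_)
  rw [Real.norm_of_nonneg (mul_nonneg (hV.2.1 x) (sq_nonneg _))]
  by_cases hx : x ∈ tsupport u
  · have : V x ≤ C := hC x (by simpa using hR hx)
    gcongr
  · simp [image_eq_zero_of_notMem_tsupport hx]

/-- A uniform upper bound for the ground state energy at masses in a bounded range. -/
lemma exists_energy_bound (hα : 0 < α) (hα1 : α < 1) (hV : V110 V) (hT : Trap V Ω c b) {A : ℝ}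
    (hA : 0 ≤ A) :
    ∃ C, 0 ≤ C ∧ ∀ a, 0 < a → a ≤ A → ∀ u, IsMinimizer V Ω a u → Ea V Ω u ≤ C := by
  obtain ⟨φ⟩ : Nonempty (ContDiffBump (0 : Plane)) := inferInstance
  set u₀ : Plane → ℂ := fun x => (φ x : ℂ)
  have hcd : ContDiff ℝ 1 u₀ := Complex.ofRealCLM.contDiff.comp φ.contDiff
  have hcs : HasCompactSupport u₀ :=
    φ.hasCompactSupport.comp_left (g := fun r : ℝ => (r : ℂ)) (by simp)
  have hu₀ := inH_of_compactSupport hV hcd hcs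
  have hcont := continuous_dens hu₀.1
  have hdc : HasCompactSupport (dens u₀) := hasCompactSupport_norm_sq hcs
  have hd2 : HasCompactSupport fun x => dens u₀ x ^ 2 :=
    hdc.comp_left (g := fun r : ℝ => r ^ 2) (by simp)
  have hf2 : Integrable fun x => dens u₀ x ^ 2 :=
    (hcont.pow 2).integrable_of_hasCompactSupport hd2
  have hfm := hu₀.integrable_norm_mul hT
  have hm : 0 < ∫ x, dens u₀ x := by
    refine hcont.integral_pos_of_hasCompactSupport_nonneg_nonzero
      hdc (dens_nonneg u₀) (x := 0) ?_
    have : φ 0 = 1 := φ.one_of_mem_closedBall (mem_closedBall_self φ.rIn_pos.le)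
    simp [dens, u₀, this]
  set m := ∫ x, dens u₀ x
  set P := ∫ x, linDens V Ω u₀ x
  set D := 1 / 2 * logForm (dens u₀) (dens u₀) - 1 / 2 * ∫ x, dens u₀ x ^ 2
  refine ⟨A / m * |P| + (A / m) ^ 2 * |D|, by positivity, fun a ha haA u hu => ?_⟩
  have hσ : 0 < a / m := div_pos ha hm
  have ht : |(0 : ℝ)| ≤ 1 / 2 := by norm_num
  have hv := hu₀.reweight cutoff_zero ht hσ
  have hv1 := integral_linDens_reweight_le hT cutoff_zero hu₀ ht hσ
  have hv2 := logConv_reweight hα hα1 cutoff_zero hu₀.1 hf2 hfm ht hσ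
  have hv3 := integral_dens_sq_reweight cutoff_zero hf2 ht hσ
  have hmass : ∫ x, dens (reweight (a / m) (fun x => 1 - 0 * 0) u₀) x = a := by
    have : ∀ x, dens (reweight (a / m) (fun x => 1 - 0 * 0) u₀) x = a / m * dens u₀ x :=
      fun x => by
        rw [dens_reweight hσ (by simp)]
        ring
    simp_rw [this]
    rw [integral_const_mul]
    exact div_mul_cancel₀ a hm.ne'
  refine (hu.2 _ ⟨hv, hmass⟩).trans ?_
  rw [Ea_eq hT hv, hv2, hv3]
  have hs : a / m ≤ A / m := by gcongr
  have h1 : a / m * P ≤ A / m * |P| :=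
    (mul_le_mul_of_nonneg_left (le_abs_self P) hσ.le).trans (by gcongr)
  have h2 : (a / m) ^ 2 * D ≤ (A / m) ^ 2 * |D| :=
    (mul_le_mul_of_nonneg_left (le_abs_self D) (sq_nonneg _)).trans (by gcongr)
  simp only [D, P] at h1 h2 ⊢
  linarith

/-- Properties of a minimizer of mass `a` that enter the estimates. -/
structure Admissible (V : Plane → ℝ) (Ω a : ℝ) (u : Plane → ℂ) : Prop where
  isMin : IsMinimizer V Ω a u
  integrable_grad : Integrable (gradAbsSq u)
  grad_pos : 0 < ∫ x, gradAbsSq u x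
  mass_pos : 0 < a

lemma Admissible.inH {a : ℝ} (h : Admissible V Ω a u) : InH V u := h.isMin.1.1

lemma Admissible.mass {a : ℝ} (h : Admissible V Ω a u) : ∫ x, dens u x = a := h.isMin.1.2

lemma Admissible.integrable_dens {a : ℝ} (h : Admissible V Ω a u) : Integrable (dens u) :=
  h.inH.1.integrable_dens

lemma Admissible.integrable_dens_sq {a : ℝ} (h : Admissible V Ω a u) :
    Integrable fun x => dens u x ^ 2 :=
  (integral_dens_sq_le h.inH.1.1 h.integrable_dens h.integrable_grad h.grad_pos
    (by rw [h.mass]; exact h.mass_pos)).1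

lemma Admissible.integral_dens_sq_le {a : ℝ} (h : Admissible V Ω a u) :
    ∫ x, dens u x ^ 2 ≤ 4 * a * ∫ x, gradAbsSq u x := by
  have := (_root_.integral_dens_sq_le h.inH.1.1 h.integrable_dens h.integrable_grad h.grad_pos
    (by rw [h.mass]; exact h.mass_pos)).2
  rwa [h.mass] at this

end Bounds

section Apriori

variable {V : Plane → ℝ} {Ω b c α A A₀ a : ℝ} {u : Plane → ℂ}

lemma Admissible.rieszC_le (h : Admissible V Ω a u) (haA : a ≤ A) :
    rieszC α (dens u) ≤ rieszJ α + 4 * A * (∫ x, gradAbsSq u x) + A := by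
  have h1 := h.integral_dens_sq_le
  have h2 : 4 * a * (∫ x, gradAbsSq u x) ≤ 4 * A * ∫ x, gradAbsSq u x := by
    have := h.grad_pos.le
    gcongr
  rw [rieszC, h.mass]
  linarith

lemma exists_moment_bound (hα : 0 < α) (hα1 : α < 1) (hV : V110 V) (hT : Trap V Ω c b)
    (hA : 0 < A) :
    ∃ C, 0 < C ∧ ∀ a u, a ≤ A → Admissible V Ω a u →
      ∫ x, ‖x‖ ^ 2 * dens u x ≤ C * (1 + ∫ x, gradAbsSq u x) := by
  obtain ⟨C₀, hC₀, hE⟩ := exists_energy_bound hα hα1 hV hT hA.le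
  have hc := hT.pos
  have hb := hT.bound_nonneg
  have hJ := rieszJ_nonneg α
  set K₁ := C₀ + b * A + 1 / 2 * A * α⁻¹ * (rieszJ α + A)
  set K₂ := 1 / 2 * A * α⁻¹ * (4 * A) + 2 * A
  have hK₁ : 0 ≤ K₁ := by positivity
  have hK₂ : 0 < K₂ := by positivity
  refine ⟨(K₁ + K₂) / c, by positivity, fun a u haA h => ?_⟩
  have h1 := hE a h.mass_pos haA u h.isMin
  rw [Ea_eq hT h.inH, logConv_eq_logForm hα hα1 h.inH.1 h.integrable_dens_sq
    (h.inH.integrable_norm_mul hT)] at h1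
  have h2 := hT.le_integral_linDens h.inH
  have h3 := le_logForm hα hα1 (dens_nonneg u) (continuous_dens h.inH.1).measurable
    h.integrable_dens h.integrable_dens_sq (h.inH.integrable_norm_mul hT)
    (continuous_dens h.inH.1).measurable (dens_nonneg u) (fun x => le_rfl)
  have h4 := h.integral_dens_sq_le
  have h5 := h.rieszC_le (α := α) haA
  rw [h.mass] at h2 h3
  have hN := h.grad_pos
  have ha := h.mass_pos
  set N := ∫ x, gradAbsSq u x
  have h6 : α⁻¹ * rieszC α (dens u) * a ≤ α⁻¹ * (rieszJ α + 4 * A * N + A) * A := by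
    gcongr
  have h7 : 4 * a * N ≤ 4 * A * N := by gcongr
  have h8 : b * a ≤ b * A := by gcongr
  rw [div_mul_eq_mul_div, le_div_iff₀ hc]
  have h9 : K₁ + K₂ * N ≤ (K₁ + K₂) * (1 + N) := by nlinarith
  have h10 : (∫ x, ‖x‖ ^ 2 * dens u x) * c ≤ K₁ + K₂ * N := by
    simp only [K₁, K₂]
    linarith
  exact h10.trans h9

lemma setIntegral_ball_compl_le {f : Plane → ℝ} (hf : ∀ x, 0 ≤ f x) (hfi : Integrable f)
    (hfs : Integrable fun x => ‖x‖ ^ 2 * f x) {r : ℝ} (hr : 0 < r) :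
    ∫ x, f x ≤ (∫ x in ball (0 : Plane) r, f x) + (∫ x, ‖x‖ ^ 2 * f x) / r ^ 2 := by
  rw [← integral_add_compl measurableSet_ball hfi]
  gcongr
  rw [← integral_div]
  have hi := hfs.div_const (r ^ 2)
  refine (setIntegral_mono_on hfi.integrableOn hi.integrableOn measurableSet_ball.compl
    fun x hx => ?_).trans (setIntegral_le_integral hi (ae_of_all _ fun x => ?_))
  · rw [mem_compl_iff, mem_ball_zero_iff, not_lt] at hx
    rw [le_div_iff₀ (by positivity), mul_comm]
    have := hf x
    gcongr
  · have := hf x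
    simp only [Pi.zero_apply]
    positivity

lemma exists_grad_lower_bound (hα : 0 < α) (hα1 : α < 1) (hV : V110 V) (hT : Trap V Ω c b)
    (hA₀ : 0 < A₀) (hA : A₀ ≤ A) :
    ∃ C, 0 < C ∧ ∀ a u, A₀ ≤ a → a ≤ A → Admissible V Ω a u → C ≤ ∫ x, gradAbsSq u x := by
  obtain ⟨C₁, hC₁, hS⟩ := exists_moment_bound hα hα1 hV hT (hA₀.trans_le hA)
  set r := √(4 * C₁ / A₀)
  have hr : 0 < r := Real.sqrt_pos.2 (by positivity)
  have hr2 : r ^ 2 = 4 * C₁ / A₀ := Real.sq_sqrt (by positivity)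
  set B := volume.real (ball (0 : Plane) r)
  have hB : 0 < B := ENNReal.toReal_pos (measure_ball_pos volume _ hr).ne'
    measure_ball_lt_top.ne
  set l := 2 * B / A₀
  have hl : 0 < l := by positivity
  refine ⟨min 1 (1 / (8 * l)), by positivity, fun a u haA₀ haA h => ?_⟩
  have hN := h.grad_pos
  have ha := h.mass_pos
  have h1 := setIntegral_ball_compl_le (dens_nonneg u) h.integrable_dens
    (h.inH.integrable_sq_mul hT) hr
  have h2 := hS a u haA h
  have h3 := h.integral_dens_sq_le
  rw [h.mass, hr2] at h1
  set N := ∫ x, gradAbsSq u x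
  by_contra! hlt
  obtain ⟨hN1, hN2⟩ := lt_min_iff.1 hlt
  have h4 : (∫ x, ‖x‖ ^ 2 * dens u x) / (4 * C₁ / A₀) ≤ A₀ / 2 := by
    rw [div_le_iff₀ (by positivity)]
    refine h2.trans ?_
    field_simp
    linarith
  have h5 : ∫ x in ball (0 : Plane) r, dens u x ≤ 1 / 2 * (l * (4 * a * N) + l⁻¹ * B) := by
    have i2 := (h.integrable_dens_sq.const_mul l).integrableOn (s := ball (0 : Plane) r)
    have i3 : IntegrableOn (fun _ : Plane => l⁻¹) (ball (0 : Plane) r) :=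
      integrableOn_const measure_ball_lt_top.ne
    calc _ ≤ ∫ x in ball (0 : Plane) r, 1 / 2 * (l * dens u x ^ 2 + l⁻¹) := by
          refine setIntegral_mono h.integrable_dens.integrableOn
            ((i2.add i3).const_mul _) fun x => ?_
          have h6 : l * dens u x ^ 2 + l⁻¹ - 2 * dens u x = l⁻¹ * (l * dens u x - 1) ^ 2 := by
            field_simp
            ring
          have h7 : 0 ≤ l⁻¹ * (l * dens u x - 1) ^ 2 := by positivity
          simp only
          linarith
      _ = 1 / 2 * (l * (∫ x in ball (0 : Plane) r, dens u x ^ 2) + l⁻¹ * B) := by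
          rw [integral_const_mul, integral_add i2 i3, integral_const_mul, setIntegral_const,
            smul_eq_mul, mul_comm B]
      _ ≤ _ := by
          have := (setIntegral_le_integral (s := ball (0 : Plane) r) h.integrable_dens_sq
            (ae_of_all _ fun x => sq_nonneg _)).trans h3
          gcongr
  have h6 : l⁻¹ * B = A₀ / 2 := by
    simp only [l]
    field_simp
  rw [h6] at h5
  rw [lt_div_iff₀ (by positivity)] at hN2
  have h7 : N * (8 * l) * a < 1 * a := by gcongr
  linarith

lemma volume_real_ball (r : ℝ) (hr : 0 ≤ r) :
    volume.real (ball (0 : Plane) r) = Real.pi * r ^ 2 := by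
  rw [measureReal_def, EuclideanSpace.volume_ball_fin_two]
  simp [hr, Real.pi_nonneg, mul_comm]

lemma Admissible.mass_le_of_max (h : Admissible V Ω a u) (hT : Trap V Ω c b) {C₁ : ℝ}
    (hC₁ : 0 < C₁) {x₀ : Plane} (hmax : ∀ y, ‖u y‖ ≤ ‖u x₀‖)
    (hS : ∫ x, ‖x‖ ^ 2 * dens u x ≤ C₁ * (1 + ∫ x, gradAbsSq u x)) :
    a ^ 2 ≤ 4 * Real.pi * C₁ * (1 + ∫ x, gradAbsSq u x) * dens u x₀ := by
  have hN := h.grad_pos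
  have ha := h.mass_pos
  set N := ∫ x, gradAbsSq u x
  set r := √(2 * C₁ * (1 + N) / a)
  have hr : 0 < r := Real.sqrt_pos.2 (by positivity)
  have hr2 : r ^ 2 = 2 * C₁ * (1 + N) / a := Real.sq_sqrt (by positivity)
  have h1 := setIntegral_ball_compl_le (dens_nonneg u) h.integrable_dens
    (h.inH.integrable_sq_mul hT) hr
  rw [h.mass] at h1
  have h2 : ∫ x in ball (0 : Plane) r, dens u x ≤ (Real.pi * r ^ 2) * dens u x₀ := by
    rw [← volume_real_ball r hr.le, ← smul_eq_mul, ← setIntegral_const]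
    refine setIntegral_mono h.integrable_dens.integrableOn
      (integrableOn_const measure_ball_lt_top.ne) fun x => ?_
    simp only [dens]
    have := hmax x
    gcongr
  have h3 : (∫ x, ‖x‖ ^ 2 * dens u x) / r ^ 2 ≤ a / 2 := by
    rw [div_le_iff₀ (by positivity), hr2]
    refine hS.trans (le_of_eq ?_)
    field_simp
  rw [hr2] at h1 h2 h3
  have h4 : a / 2 ≤ Real.pi * (2 * C₁ * (1 + N) / a) * dens u x₀ := by linarith
  calc a ^ 2 = 2 * a * (a / 2) := by ring
    _ ≤ 2 * a * (Real.pi * (2 * C₁ * (1 + N) / a) * dens u x₀) := by gcongr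
    _ = _ := by
      field_simp
      ring

/-- The gradient flux through a cutoff is controlled by the mass it carries. -/
lemma Admissible.grad_flux_le (hα : 0 < α) (hα1 : α < 1) (hT : Trap V Ω c b)
    (h : Admissible V Ω a u) {C₀ L : ℝ} (hE : Ea V Ω u ≤ C₀) {x₀ : Plane}
    (hmax : ∀ y, ‖u y‖ ≤ ‖u x₀‖) {η : Plane → ℝ} (hη : Cutoff η L) :
    1 / 2 * (∫ x, (d0R η x * d0R (dens u) x + d1R η x * d1R (dens u) x)) ≤
      (C₀ / a + (∫ x, ‖x‖ * dens u x) + α⁻¹ * rieszC α (dens u) + dens u x₀) *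
        ∫ x, η x * dens u x := by
  have hu := h.inH
  have ha := h.mass_pos
  have hfm := hu.integrable_norm_mul hT
  have hf2 := h.integrable_dens_sq
  have hM := (continuous_dens hu.1).measurable
  have hfv := first_variation hα hα1 hT hη ha h.isMin hf2
  rw [Ea_eq hT hu, logConv_eq_logForm hα hα1 hu.1 hf2 hfm] at hE
  have h1 : 0 ≤ ∫ x, η x * linDens V Ω u x := integral_nonneg fun x =>
    mul_nonneg (hη.nonneg x) ((mul_nonneg (hT.nonneg x) (dens_nonneg u x)).trans
      (le_linDens V Ω u x))
  have h2 := le_logForm (g₁ := fun x => η x * dens u x) hα hα1 (dens_nonneg u) hM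
    h.integrable_dens hf2 hfm (hη.diff.continuous.measurable.mul hM) (fun x => mul_nonneg (hη.nonneg x) (dens_nonneg u x))
    (fun x => mul_le_of_le_one_left (dens_nonneg u x) (hη.le_one x))
  have h3 : ∫ x, η x * dens u x ^ 2 ≤ dens u x₀ * ∫ x, η x * dens u x := by
    rw [← integral_const_mul]
    refine integral_mono (hη.integrable_mul hf2)
      ((hη.integrable_mul h.integrable_dens).const_mul _) fun x => ?_
    have h4 : dens u x ≤ dens u x₀ := by
      simp only [dens]
      have := hmax x
      gcongr
    have h5 := mul_le_mul_of_nonneg_left h4 (mul_nonneg (hη.nonneg x) (dens_nonneg u x))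
    simp only
    linarith
  have h4 := logForm_self_le hα hα1 (dens_nonneg u) h.integrable_dens hf2 hfm
  rw [h.mass] at h4
  have h5 : 0 ≤ ∫ x, dens u x ^ 2 := integral_nonneg fun x => sq_nonneg _
  have hm := hη.integral_mul_nonneg u
  set m := ∫ x, η x * dens u x
  have h6 : m / a * ((∫ x, linDens V Ω u x)
      + 2 * (1 / 2 * logForm (dens u) (dens u) - 1 / 2 * ∫ x, dens u x ^ 2)) ≤
      m / a * (C₀ + a * ∫ x, ‖x‖ * dens u x) := by
    refine mul_le_mul_of_nonneg_left ?_ (by positivity)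
    linarith
  have h7 : m / a * (C₀ + a * ∫ x, ‖x‖ * dens u x) =
      (C₀ / a + ∫ x, ‖x‖ * dens u x) * m := by
    field_simp
  rw [h7] at h6
  linarith

end Apriori

section HeatKernel

variable {c κ : ℝ} {f : Plane → ℝ} {x₀ : Plane}

/-- The Gaussian centred at `x₀`. -/
def gauss (c : ℝ) (x₀ x : Plane) : ℝ := Real.exp (-(c * ‖x - x₀‖ ^ 2))

lemma gauss_pos (c : ℝ) (x₀ x : Plane) : 0 < gauss c x₀ x := Real.exp_pos _

lemma gauss_le_one (hc : 0 ≤ c) (x₀ x : Plane) : gauss c x₀ x ≤ 1 :=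
  Real.exp_le_one_iff.2 (by have : 0 ≤ c * ‖x - x₀‖ ^ 2 := by positivity
                            linarith)

lemma sq_mul_gauss_le (c : ℝ) (x₀ x : Plane) : c * ‖x - x₀‖ ^ 2 * gauss c x₀ x ≤ 1 :=
  (Real.mul_exp_neg_le_exp_neg_one _).trans (Real.exp_le_one_iff.2 (by norm_num))

lemma hasFDerivAt_gauss (c : ℝ) (x₀ x : Plane) :
    HasFDerivAt (gauss c x₀) (-(2 * c * gauss c x₀ x) • innerSL ℝ (x - x₀)) x := by
  have h1 : HasFDerivAt (fun y => ‖y - x₀‖ ^ 2) _ x :=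
    ((hasFDerivAt_id (𝕜 := ℝ) x).sub_const x₀).norm_sq
  have h2 : HasFDerivAt (gauss c x₀) _ x := (h1.const_mul c).neg.exp
  refine h2.congr_fderiv ?_
  ext v
  simp [gauss]
  ring

lemma differentiable_gauss (c : ℝ) (x₀ : Plane) : Differentiable ℝ (gauss c x₀) :=
  fun x => (hasFDerivAt_gauss c x₀ x).differentiableAt

lemma continuous_gauss (c : ℝ) (x₀ : Plane) : Continuous (gauss c x₀) :=
  (differentiable_gauss c x₀).continuous

lemma fderiv_gauss (c : ℝ) (x₀ x v : Plane) :
    fderiv ℝ (gauss c x₀) x v = -(2 * c) * (inner ℝ (x - x₀) v * gauss c x₀ x) := by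
  rw [(hasFDerivAt_gauss c x₀ x).fderiv]
  simp [inner_sub_left]
  ring

lemma fderiv_fderiv_gauss (c : ℝ) (x₀ x : Plane) {v : Plane} (hv : ‖v‖ = 1) :
    fderiv ℝ (fun y => fderiv ℝ (gauss c x₀) y v) x v =
      (4 * c ^ 2 * inner ℝ (x - x₀) v ^ 2 - 2 * c) * gauss c x₀ x := by
  have h1 : HasFDerivAt (fun y : Plane => inner ℝ (y - x₀) v) (innerSL ℝ v) x := by
    have : ∀ y : Plane, inner ℝ (y - x₀) v = innerSL ℝ v y - inner ℝ x₀ v := fun y => by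
      rw [inner_sub_left, innerSL_apply_apply, real_inner_comm]
    simp_rw [this]
    exact (innerSL ℝ v).hasFDerivAt.sub_const _
  have h2 := (h1.fun_mul (hasFDerivAt_gauss c x₀ x)).const_mul (-(2 * c))
  rw [funext fun y => fderiv_gauss c x₀ y v, h2.fderiv]
  simp [hv, inner_sub_left]
  ring

lemma differentiable_fderiv_gauss (c : ℝ) (x₀ v : Plane) :
    Differentiable ℝ fun y => fderiv ℝ (gauss c x₀) y v := by
  rw [funext fun y => fderiv_gauss c x₀ y v]
  exact ((((differentiable_id.sub_const x₀).inner ℝ (differentiable_const v)).mul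
    (differentiable_gauss c x₀)).const_mul _)

lemma abs_fderiv_gauss_le (hc : 0 < c) (x₀ x : Plane) {v : Plane} (hv : ‖v‖ = 1) :
    |fderiv ℝ (gauss c x₀) x v| ≤ 2 * c + 2 := by
  have hg := gauss_pos c x₀ x
  have h1 := abs_real_inner_le_norm (x - x₀) v
  rw [hv, mul_one] at h1
  have h2 := sq_mul_gauss_le c x₀ x
  have h3 := gauss_le_one hc.le x₀ x
  have h4 : ‖x - x₀‖ ≤ 1 + ‖x - x₀‖ ^ 2 := by nlinarith [sq_nonneg (‖x - x₀‖ - 1)]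
  rw [fderiv_gauss, abs_mul, abs_mul, abs_of_pos hg, abs_neg, abs_of_pos (by positivity)]
  calc 2 * c * (|inner ℝ (x - x₀) v| * gauss c x₀ x)
      ≤ 2 * c * ((1 + ‖x - x₀‖ ^ 2) * gauss c x₀ x) := by
        gcongr
        exact h1.trans h4
    _ = 2 * (c * gauss c x₀ x + c * ‖x - x₀‖ ^ 2 * gauss c x₀ x) := by ring
    _ ≤ 2 * (c * 1 + 1) := by gcongr
    _ = _ := by ring

lemma cutoff_gauss (hc : 0 < c) (x₀ : Plane) : Cutoff (gauss c x₀) (2 * c + 2) :=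
  ⟨differentiable_gauss c x₀, fun x => (gauss_pos c x₀ x).le, gauss_le_one hc.le x₀,
    fun x => abs_fderiv_gauss_le hc x₀ x norm_e0, fun x => abs_fderiv_gauss_le hc x₀ x norm_e1⟩

lemma integrable_gauss_mul (hc : 0 < c) (x₀ : Plane) (hfi : Integrable f) :
    Integrable fun x => gauss c x₀ x * f x :=
  (cutoff_gauss hc x₀).integrable_mul hfi

lemma integrable_sq_mul_gauss_mul (hc : 0 < c) (x₀ : Plane) (hfi : Integrable f) :
    Integrable fun x => c * ‖x - x₀‖ ^ 2 * gauss c x₀ x * f x := by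
  have h := continuous_gauss c x₀
  refine hfi.bdd_mul (c := 1) (Continuous.aestronglyMeasurable (by fun_prop))
    (ae_of_all _ fun x => ?_)
  have := gauss_pos c x₀ x
  rw [Real.norm_of_nonneg (by positivity)]
  exact sq_mul_gauss_le c x₀ x

lemma integral_fderiv_gauss_mul (hc : 0 < c) (x₀ : Plane) (hf : Differentiable ℝ f)
    (hfi : Integrable f) {v : Plane} (hv : ‖v‖ = 1)
    (hd : Integrable fun x => fderiv ℝ f x v) :
    Integrable (fun x => (4 * c ^ 2 * inner ℝ (x - x₀) v ^ 2 - 2 * c) * gauss c x₀ x * f x) ∧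
    ∫ x, fderiv ℝ (gauss c x₀) x v * fderiv ℝ f x v =
      -∫ x, (4 * c ^ 2 * inner ℝ (x - x₀) v ^ 2 - 2 * c) * gauss c x₀ x * f x := by
  have hd' := differentiable_fderiv_gauss c x₀ v
  have h := continuous_gauss c x₀
  have i0 : Integrable
      (fun x => (4 * c ^ 2 * inner ℝ (x - x₀) v ^ 2 - 2 * c) * gauss c x₀ x * f x) := by
    refine hfi.bdd_mul (c := 4 * c + 2 * c) (Continuous.aestronglyMeasurable (by fun_prop))
      (ae_of_all _ fun x => ?_)
    have hg := gauss_pos c x₀ x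
    have h1 := abs_real_inner_le_norm (x - x₀) v
    rw [hv, mul_one] at h1
    have h2 : inner ℝ (x - x₀) v ^ 2 ≤ ‖x - x₀‖ ^ 2 := by
      rw [← sq_abs]
      gcongr
    have h3 := sq_mul_gauss_le c x₀ x
    have h4 := gauss_le_one hc.le x₀ x
    have h5 : c * inner ℝ (x - x₀) v ^ 2 * gauss c x₀ x ≤ 1 :=
      h3.trans' (by gcongr)
    have h6 : 0 ≤ c * inner ℝ (x - x₀) v ^ 2 * gauss c x₀ x := by positivity
    have h7 : (4 * c ^ 2 * inner ℝ (x - x₀) v ^ 2 - 2 * c) * gauss c x₀ x =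
        4 * c * (c * inner ℝ (x - x₀) v ^ 2 * gauss c x₀ x) - 2 * c * gauss c x₀ x := by ring
    rw [h7, Real.norm_eq_abs, abs_le]
    have h8 : 4 * c * (c * inner ℝ (x - x₀) v ^ 2 * gauss c x₀ x) ≤ 4 * c * 1 := by gcongr
    have h9 : 2 * c * gauss c x₀ x ≤ 2 * c * 1 := by gcongr
    have h10 : 0 ≤ 4 * c * (c * inner ℝ (x - x₀) v ^ 2 * gauss c x₀ x) := by positivity
    have h11 : 0 ≤ 2 * c * gauss c x₀ x := by positivity
    constructor <;> linarith
  refine ⟨i0, ?_⟩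
  have hb : ∀ g : Plane → ℝ, Integrable g →
      Integrable fun x => fderiv ℝ (gauss c x₀) x v * g x := fun g hg =>
    hg.bdd_mul (c := 2 * c + 2) hd'.continuous.aestronglyMeasurable
      (ae_of_all _ fun x => abs_fderiv_gauss_le hc x₀ x hv)
  rw [integral_mul_fderiv_eq_neg_fderiv_mul_of_integrable
    (by simp_rw [fderiv_fderiv_gauss c x₀ _ hv]; exact i0) (hb _ hd) (hb _ hfi)
    (fun x _ => hd' x) (fun x _ => hf x)]
  simp_rw [fderiv_fderiv_gauss c x₀ _ hv]

lemma gauss_flux_eq (hc : 0 < c) (x₀ : Plane) (hf : Differentiable ℝ f)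
    (hfi : Integrable f) (h0 : Integrable (d0R f)) (h1 : Integrable (d1R f)) :
    1 / 2 * (∫ x, (d0R (gauss c x₀) x * d0R f x + d1R (gauss c x₀) x * d1R f x)) =
      2 * c * ((∫ x, gauss c x₀ x * f x) - ∫ x, c * ‖x - x₀‖ ^ 2 * gauss c x₀ x * f x) := by
  have hb : ∀ v : Plane, ‖v‖ = 1 → (Integrable fun x => fderiv ℝ f x v) →
      Integrable fun x => fderiv ℝ (gauss c x₀) x v * fderiv ℝ f x v := fun v hv hg =>
    hg.bdd_mul (c := 2 * c + 2) (differentiable_fderiv_gauss c x₀ v).continuous.aestronglyMeasurable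
      (ae_of_all _ fun x => abs_fderiv_gauss_le hc x₀ x hv)
  obtain ⟨i0, k0⟩ := integral_fderiv_gauss_mul hc x₀ hf hfi norm_e0 h0
  obtain ⟨i1, k1⟩ := integral_fderiv_gauss_mul hc x₀ hf hfi norm_e1 h1
  have h2 := integral_add (hb e0 norm_e0 h0) (hb e1 norm_e1 h1)
  simp only [d0R, d1R]
  rw [h2, k0, k1, ← neg_add, ← integral_add i0 i1, ← integral_sub (integrable_gauss_mul hc x₀ hfi)
    (integrable_sq_mul_gauss_mul hc x₀ hfi), ← integral_const_mul, ← integral_neg,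
    ← integral_const_mul]
  refine integral_congr_ae (ae_of_all _ fun x => ?_)
  have e : ‖x - x₀‖ ^ 2 = inner ℝ (x - x₀) e0 ^ 2 + inner ℝ (x - x₀) e1 ^ 2 := by
    rw [norm_sq_plane]
    simp [e0, e1, EuclideanSpace.inner_single_right]
  simp only
  rw [e]
  ring

lemma hasDerivAt_integral_gauss (hc : 0 < c) (x₀ : Plane) (hf : ∀ x, 0 ≤ f x)
    (hfi : Integrable f) :
    HasDerivAt (fun s => ∫ x, s * (gauss s x₀ x * f x))
      ((∫ x, gauss c x₀ x * f x) - ∫ x, c * ‖x - x₀‖ ^ 2 * gauss c x₀ x * f x) c := by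
  have hg := fun s => continuous_gauss s x₀
  rw [← integral_sub (integrable_gauss_mul hc x₀ hfi) (integrable_sq_mul_gauss_mul hc x₀ hfi)]
  refine (hasDerivAt_integral_of_dominated_loc_of_deriv_le (μ := volume) (bound := fun x => 2 * f x)
    (F' := fun s x => gauss s x₀ x * f x - s * ‖x - x₀‖ ^ 2 * gauss s x₀ x * f x)
    (Ioi_mem_nhds hc) (Eventually.of_forall fun s => ?_)
    ((integrable_gauss_mul hc x₀ hfi).const_mul c) ?_ (ae_of_all _ fun x s hs => ?_)
    (hfi.const_mul 2) (ae_of_all _ fun x s hs => ?_)).2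
  · exact (((hg s).aestronglyMeasurable.mul hfi.aestronglyMeasurable).const_mul s)
  · exact ((integrable_gauss_mul hc x₀ hfi).sub
      (integrable_sq_mul_gauss_mul hc x₀ hfi)).aestronglyMeasurable
  · have hs' : 0 < s := hs
    have h1 := gauss_le_one hs'.le x₀ x
    have h2 := sq_mul_gauss_le s x₀ x
    have h3 := gauss_pos s x₀ x
    have h4 : 0 ≤ s * ‖x - x₀‖ ^ 2 * gauss s x₀ x := by positivity
    rw [← sub_mul, norm_mul, Real.norm_of_nonneg (hf x)]
    refine mul_le_mul_of_nonneg_right ?_ (hf x)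
    rw [Real.norm_eq_abs, abs_le]
    constructor <;> linarith
  · have h1 : HasDerivAt (fun s => gauss s x₀ x) _ s :=
      ((hasDerivAt_id s).mul_const (‖x - x₀‖ ^ 2)).fun_neg.exp
    have h2 := (hasDerivAt_id s).fun_mul (h1.mul_const (f x))
    refine h2.congr_deriv ?_
    simp [gauss]
    ring

lemma tendsto_integral_gauss (x₀ : Plane) (hfi : Integrable f) (hfc : Continuous f) :
    Tendsto (fun s : ℝ => ∫ x, s ^ 2 * (gauss (s ^ 2) x₀ x * f x)) atTop
      (𝓝 (Real.pi * f x₀)) := by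
  have h1 : ∫ x : Plane, Real.exp (-(1 : ℝ) * ‖x‖ ^ 2) = Real.pi := by
    rw [GaussianFourier.integral_rexp_neg_mul_sq_norm one_pos, finrank_plane]
    simp
  have h := tendsto_integral_comp_smul_smul_of_integrable' (μ := volume) (E := ℝ) (F := Plane)
    (φ := fun x => Real.pi⁻¹ * Real.exp (-(1 : ℝ) * ‖x‖ ^ 2)) (fun x => by positivity)
    (by rw [integral_const_mul, h1, inv_mul_cancel₀ Real.pi_ne_zero]) ?_ hfi
    (x₀ := x₀) hfc.continuousAt
  · have h2 := h.const_mul Real.pi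
    refine h2.congr fun s => ?_
    rw [← integral_const_mul]
    refine integral_congr_ae (ae_of_all _ fun x => ?_)
    have := Real.pi_pos
    simp only [finrank_plane, gauss, smul_eq_mul, norm_smul, mul_pow, norm_sub_rev x₀, neg_mul,
      one_mul, Real.norm_eq_abs, sq_abs]
    field_simp
  · have hA : Tendsto (fun x : Plane => ‖x‖ ^ 2) (Bornology.cobounded Plane) atTop :=
      (tendsto_pow_atTop two_ne_zero).comp tendsto_norm_cobounded_atTop
    have hB := ((Real.tendsto_pow_mul_exp_neg_atTop_nhds_zero 1).comp hA).const_mul Real.pi⁻¹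
    rw [mul_zero] at hB
    refine hB.congr fun x => ?_
    simp only [finrank_plane, Function.comp_apply, pow_one]
    ring_nf

/-- A mean-value type inequality for nonnegative functions satisfying a weak differential
inequality `-Δ f ≤ 4 κ f`. -/
lemma pi_mul_le_of_gauss_flux (hκ : 0 < κ) (hf : ∀ x, 0 ≤ f x) (hfd : Differentiable ℝ f)
    (hfi : Integrable f) (h0 : Integrable (d0R f)) (h1 : Integrable (d1R f))
    (hflux : ∀ c, 0 < c →
      1 / 2 * (∫ x, (d0R (gauss c x₀) x * d0R f x + d1R (gauss c x₀) x * d1R f x)) ≤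
        2 * κ * ∫ x, gauss c x₀ x * f x) :
    Real.pi * f x₀ ≤ Real.exp 1 * (κ * ∫ x, gauss κ x₀ x * f x) := by
  set B : ℝ → ℝ := fun s => ∫ x, s * (gauss s x₀ x * f x)
  have hB : ∀ s, B s = s * ∫ x, gauss s x₀ x * f x := fun s => integral_const_mul _ _
  set B' : ℝ → ℝ := fun s => (∫ x, gauss s x₀ x * f x)
    - ∫ x, s * ‖x - x₀‖ ^ 2 * gauss s x₀ x * f x
  have hd : ∀ s, 0 < s → HasDerivAt B (B' s) s := fun s hs => hasDerivAt_integral_gauss hs x₀ hf hfi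
  have hG : ∀ s, 0 < s → HasDerivAt (fun s => B s * Real.exp (κ / s))
      (B' s * Real.exp (κ / s) + B s * (Real.exp (κ / s) * (-κ / s ^ 2))) s := fun s hs => by
    refine (hd s hs).fun_mul (HasDerivAt.exp ?_)
    have := (hasDerivAt_const s κ).fun_div (hasDerivAt_id s) hs.ne'
    refine this.congr_deriv ?_
    simp
  have hanti : AntitoneOn (fun s => B s * Real.exp (κ / s)) (Ioi 0) := by
    refine antitoneOn_of_deriv_nonpos (convex_Ioi 0)
      (fun s hs => (hG s hs).continuousAt.continuousWithinAt) (fun s hs => ?_) fun s hs => ?_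
    · rw [interior_Ioi] at hs
      exact (hG s hs).differentiableAt.differentiableWithinAt
    · rw [interior_Ioi] at hs
      have hs' : 0 < s := hs
      rw [(hG s hs).deriv, hB]
      have h2 := hflux s hs
      rw [gauss_flux_eq hs x₀ hfd hfi h0 h1] at h2
      have h3 : s * B' s ≤ κ * ∫ x, gauss s x₀ x * f x := by
        simp only [B']
        linarith
      have h4 : B' s * Real.exp (κ / s) + s * (∫ x, gauss s x₀ x * f x) *
          (Real.exp (κ / s) * (-κ / s ^ 2)) =
          Real.exp (κ / s) / s * (s * B' s - κ * ∫ x, gauss s x₀ x * f x) := by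
        field_simp
        ring
      rw [h4]
      exact mul_nonpos_of_nonneg_of_nonpos (by positivity) (by linarith)
  have hlim := tendsto_integral_gauss x₀ hfi hfd.continuous
  refine le_of_tendsto hlim ?_
  have hev : ∀ᶠ s : ℝ in atTop, κ ≤ s ^ 2 := (tendsto_pow_atTop two_ne_zero).eventually_ge_atTop κ
  filter_upwards [hev] with s hs
  have hs0 : 0 < s ^ 2 := hκ.trans_le hs
  have h2 := hanti hκ hs0 hs
  simp only at h2
  rw [div_self hκ.ne', hB κ] at h2
  have h3 : B (s ^ 2) * 1 ≤ B (s ^ 2) * Real.exp (κ / s ^ 2) := by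
    have h4 : 0 ≤ B (s ^ 2) := by
      rw [hB]
      exact mul_nonneg hs0.le (integral_nonneg fun x => mul_nonneg (gauss_pos _ _ _).le (hf x))
    have h5 : 1 ≤ Real.exp (κ / s ^ 2) := Real.one_le_exp (by positivity)
    gcongr
  simp only [B] at h3 h2
  linarith

end HeatKernel

section Location

variable {V : Plane → ℝ} {Ω b c α A A₀ a κ : ℝ} {u : Plane → ℂ}

lemma exists_norm_moment_add_rieszC_bound (hα : 0 < α) (hα1 : α < 1) (hV : V110 V)
    (hT : Trap V Ω c b) (hA : 0 < A) :
    ∃ C, 0 < C ∧ ∀ a u, a ≤ A → Admissible V Ω a u →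
      (∫ x, ‖x‖ * dens u x) + α⁻¹ * rieszC α (dens u) ≤ C * (1 + ∫ x, gradAbsSq u x) := by
  obtain ⟨C₁, hC₁, hS⟩ := exists_moment_bound hα hα1 hV hT hA
  have hJ := rieszJ_nonneg α
  refine ⟨A + C₁ + α⁻¹ * (rieszJ α + 5 * A), by positivity, fun a u haA h => ?_⟩
  have h1 := hS a u haA h
  have h2 := h.rieszC_le (α := α) haA
  have hs := h.inH.integrable_sq_mul hT
  have h3 : ∫ x, ‖x‖ * dens u x ≤ a + ∫ x, ‖x‖ ^ 2 * dens u x := by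
    rw [← h.mass, ← integral_add h.integrable_dens hs]
    refine integral_mono (h.inH.integrable_norm_mul hT) (h.integrable_dens.add hs) fun x => ?_
    have h4 : ‖x‖ ≤ 1 + ‖x‖ ^ 2 := by nlinarith [sq_nonneg (‖x‖ - 1)]
    have h5 := mul_le_mul_of_nonneg_right h4 (dens_nonneg u x)
    simp only
    linarith
  have hN := h.grad_pos
  set N := ∫ x, gradAbsSq u x
  have h4 : α⁻¹ * rieszC α (dens u) ≤ α⁻¹ * (rieszJ α + 4 * A * N + A) := by gcongr
  have h5 : α⁻¹ * (rieszJ α + 4 * A * N + A) ≤ α⁻¹ * ((rieszJ α + 5 * A) * (1 + N)) := by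
    refine mul_le_mul_of_nonneg_left ?_ (by positivity)
    nlinarith [mul_nonneg hJ hN.le, mul_nonneg hA.le hN.le]
  nlinarith [mul_nonneg hA.le hN.le]

lemma norm_sq_mul_integral_gauss_le {f : Plane → ℝ} (hκ : 0 < κ) (hf : ∀ x, 0 ≤ f x)
    (hfi : Integrable f) (hfs : Integrable fun x => ‖x‖ ^ 2 * f x) (x₀ : Plane) :
    ‖x₀‖ ^ 2 * (κ * ∫ x, gauss κ x₀ x * f x) ≤
      2 * κ * (∫ x, ‖x‖ ^ 2 * f x) + 2 * ∫ x, f x := by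
  have hi := integrable_gauss_mul hκ x₀ hfi
  rw [← integral_const_mul, ← integral_const_mul, ← integral_const_mul, ← integral_const_mul,
    ← integral_add (hfs.const_mul _) (hfi.const_mul _)]
  refine integral_mono ((hi.const_mul _).const_mul _)
    ((hfs.const_mul _).add (hfi.const_mul _)) fun x => ?_
  have h1 := gauss_le_one hκ.le x₀ x
  have h2 := sq_mul_gauss_le κ x₀ x
  have h3 := gauss_pos κ x₀ x
  have h4 : ‖x₀‖ ^ 2 ≤ 2 * ‖x‖ ^ 2 + 2 * ‖x - x₀‖ ^ 2 := by
    have h5 : ‖x₀‖ ≤ ‖x‖ + ‖x - x₀‖ := by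
      have := norm_sub_le x (x - x₀)
      rwa [sub_sub_cancel] at this
    calc _ ≤ (‖x‖ + ‖x - x₀‖) ^ 2 := by gcongr
      _ ≤ _ := by nlinarith [sq_nonneg (‖x‖ - ‖x - x₀‖)]
  have h5 : ‖x₀‖ ^ 2 * (κ * gauss κ x₀ x) ≤ 2 * κ * ‖x‖ ^ 2 + 2 :=
    calc _ ≤ (2 * ‖x‖ ^ 2 + 2 * ‖x - x₀‖ ^ 2) * (κ * gauss κ x₀ x) := by gcongr
      _ = 2 * κ * ‖x‖ ^ 2 * gauss κ x₀ x + 2 * (κ * ‖x - x₀‖ ^ 2 * gauss κ x₀ x) := by ring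
      _ ≤ 2 * κ * ‖x‖ ^ 2 * 1 + 2 * 1 := by gcongr
      _ = _ := by ring
  calc _ = ‖x₀‖ ^ 2 * (κ * gauss κ x₀ x) * f x := by ring
    _ ≤ (2 * κ * ‖x‖ ^ 2 + 2) * f x := mul_le_mul_of_nonneg_right h5 (hf x)
    _ = _ := by ring

/-- A maximum point of `|u|` cannot be far away from the origin. -/
lemma exists_max_location_bound (hα : 0 < α) (hα1 : α < 1) (hV : V110 V) (hT : Trap V Ω c b)
    (hA₀ : 0 < A₀) (hA : A₀ ≤ A) :
    ∃ C, 0 < C ∧ ∀ a u x₀, A₀ ≤ a → a ≤ A → Admissible V Ω a u → (∀ y, ‖u y‖ ≤ ‖u x₀‖) →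
      ‖x₀‖ ^ 2 ≤ C * (1 + ∫ x, gradAbsSq u x) ^ 3 := by
  have hA' := hA₀.trans_le hA
  obtain ⟨C₀, hC₀, hE⟩ := exists_energy_bound hα hα1 hV hT hA'.le
  obtain ⟨C₁, hC₁, hS⟩ := exists_moment_bound hα hα1 hV hT hA'
  obtain ⟨C₂, hC₂, hR⟩ := exists_norm_moment_add_rieszC_bound hα hα1 hV hT hA'
  set P := 4 * Real.pi * C₁ / A₀ ^ 2
  have hP : 0 < P := by positivity
  refine ⟨Real.exp 1 * (C₁ + ((C₀ / A₀ + C₂) * C₁ + 2 * A) * P), by positivity,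
    fun a u x₀ haA₀ haA h hmax => ?_⟩
  have hS' := hS a u haA h
  have hR' := hR a u haA h
  have hM' := h.mass_le_of_max hT hC₁ hmax hS'
  have hN := h.grad_pos
  have ha := h.mass_pos
  have hs := h.inH.integrable_sq_mul hT
  have hS0 : 0 ≤ ∫ x, ‖x‖ ^ 2 * dens u x :=
    integral_nonneg fun x => mul_nonneg (sq_nonneg _) (dens_nonneg u x)
  have hT0 : 0 ≤ ∫ x, ‖x‖ * dens u x :=
    integral_nonneg fun x => mul_nonneg (norm_nonneg _) (dens_nonneg u x)
  have hr0 := rieszC_nonneg α (dens_nonneg u)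
  have hflux := fun s (hs : 0 < s) =>
    h.grad_flux_le hα hα1 hT (hE a ha haA u h.isMin) hmax (cutoff_gauss hs x₀)
  set N := ∫ x, gradAbsSq u x
  have hM : 1 ≤ P * (1 + N) * dens u x₀ := by
    have h1 : A₀ ^ 2 ≤ a ^ 2 := by gcongr
    simp only [P]
    rw [div_mul_eq_mul_div, div_mul_eq_mul_div, le_div_iff₀ (by positivity)]
    linarith
  have hM0 : 0 < dens u x₀ :=
    pos_of_mul_pos_right (one_pos.trans_le hM) (by positivity)
  set K := C₀ / a + (∫ x, ‖x‖ * dens u x) + α⁻¹ * rieszC α (dens u)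
  have hK0 : 0 ≤ K := by positivity
  have hK : K ≤ (C₀ / A₀ + C₂) * (1 + N) := by
    have h1 : C₀ / a ≤ C₀ / A₀ := by gcongr
    have h2 : 0 ≤ C₀ / A₀ * N := by positivity
    simp only [K]
    linarith
  have hκ : 0 < (K + dens u x₀) / 2 := by positivity
  have h1 := pi_mul_le_of_gauss_flux (x₀ := x₀) hκ (dens_nonneg u)
    (differentiable_dens h.inH.1.1) h.integrable_dens
    (h.inH.1.integrable_fderiv_dens (Or.inl rfl)) (h.inH.1.integrable_fderiv_dens (Or.inr rfl))
    fun s hs => by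
      rw [mul_div_cancel₀ _ two_ne_zero]
      exact hflux s hs
  have h2 := norm_sq_mul_integral_gauss_le hκ (dens_nonneg u) h.integrable_dens hs x₀
  rw [h.mass, mul_div_cancel₀ _ two_ne_zero] at h2
  set S := ∫ x, ‖x‖ ^ 2 * dens u x
  set M := dens u x₀
  set I := (K + M) / 2 * ∫ x, gauss ((K + M) / 2) x₀ x * dens u x
  have h3 : ‖x₀‖ ^ 2 * M ≤ Real.exp 1 * ((K + M) * S + 2 * a) := by
    calc ‖x₀‖ ^ 2 * M = ‖x₀‖ ^ 2 * (1 * M) := by ring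
      _ ≤ ‖x₀‖ ^ 2 * (Real.pi * M) := by
        have := Real.pi_gt_three
        gcongr
        linarith
      _ ≤ ‖x₀‖ ^ 2 * (Real.exp 1 * I) := by gcongr
      _ = Real.exp 1 * (‖x₀‖ ^ 2 * I) := by ring
      _ ≤ _ := by gcongr
  have h4 : (K + M) * S + 2 * a ≤ (S + (K * S + 2 * a) * (P * (1 + N))) * M := by
    have : (K * S + 2 * a) * 1 ≤ (K * S + 2 * a) * (P * (1 + N) * M) := by gcongr
    linarith
  have h5 : S + (K * S + 2 * a) * (P * (1 + N)) ≤
      (C₁ + ((C₀ / A₀ + C₂) * C₁ + 2 * A) * P) * (1 + N) ^ 3 := by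
    have hN1 : 1 ≤ 1 + N := by linarith
    calc _ ≤ C₁ * (1 + N) + ((C₀ / A₀ + C₂) * (1 + N) * (C₁ * (1 + N)) + 2 * A)
          * (P * (1 + N)) := by gcongr
      _ ≤ C₁ * (1 + N) ^ 3 + ((C₀ / A₀ + C₂) * (1 + N) * (C₁ * (1 + N)) + 2 * A * (1 + N) ^ 2)
          * (P * (1 + N)) := by
        refine add_le_add (mul_le_mul_of_nonneg_left (le_self_pow₀ hN1 (by norm_num)) hC₁.le)
          (mul_le_mul_of_nonneg_right (add_le_add le_rfl ?_) (by positivity))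
        exact le_mul_of_one_le_right (by positivity) (one_le_pow₀ hN1)
      _ = _ := by ring
  refine le_of_mul_le_mul_right (h3.trans ?_) hM0
  calc _ ≤ Real.exp 1 * ((S + (K * S + 2 * a) * (P * (1 + N))) * M) := by gcongr
    _ ≤ Real.exp 1 * ((C₁ + ((C₀ / A₀ + C₂) * C₁ + 2 * A) * P) * (1 + N) ^ 3 * M) := by gcongr
    _ = _ := by ring

lemma exists_log_max_location_bound (hα : 0 < α) (hα1 : α < 1) (hV : V110 V)
    (hT : Trap V Ω c b) (hA₀ : 0 < A₀) (hA : A₀ ≤ A) :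
    ∃ C, 0 < C ∧ ∀ a u x₀, A₀ ≤ a → a ≤ A → Admissible V Ω a u → (∀ y, ‖u y‖ ≤ ‖u x₀‖) →
      Real.log (1 + ‖x₀‖) ≤ C * (1 + ∫ x, gradAbsSq u x) := by
  obtain ⟨D, hD, hx⟩ := exists_max_location_bound hα hα1 hV hT hA₀ hA
  have hl : 0 ≤ Real.log (2 + 2 * D) := Real.log_nonneg (by linarith)
  refine ⟨Real.log (2 + 2 * D) + 3, by positivity, fun a u x₀ haA₀ haA h hmax => ?_⟩
  have h1 := hx a u x₀ haA₀ haA h hmax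
  have hN := h.grad_pos
  set N := ∫ x, gradAbsSq u x
  have h2 : (1 + ‖x₀‖) ^ 2 ≤ (2 + 2 * D) * (1 + N) ^ 3 := by
    have h3 : (1 : ℝ) ≤ (1 + N) ^ 3 := one_le_pow₀ (by linarith)
    nlinarith [sq_nonneg (‖x₀‖ - 1)]
  have h3 := Real.log_le_log (by positivity) h2
  rw [Real.log_mul (by positivity) (by positivity), Real.log_pow, Real.log_pow] at h3
  have h4 := Real.log_le_sub_one_of_pos (show 0 < 1 + N by positivity)
  push_cast at h3
  have h5 : 0 ≤ Real.log (1 + ‖x₀‖) := Real.log_nonneg (by linarith [norm_nonneg x₀])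
  nlinarith [mul_nonneg hl hN.le]

end Location

section Rescaling

variable {α ε : ℝ} {f F : Plane → ℝ} {x₀ : Plane}

lemma integral_rescale (hε : 0 < ε) (x₀ : Plane) (F : Plane → ℝ) :
    ∫ z, ε ^ 2 * F (ε • z + x₀) = ∫ x, F x := by
  rw [integral_const_mul, Measure.integral_comp_smul volume (fun x => F (x + x₀)) ε,
    integral_add_right_eq_self, finrank_plane, abs_of_pos (by positivity), smul_eq_mul,
    mul_inv_cancel_left₀ (by positivity)]

lemma integrable_rescale (hε : 0 < ε) (x₀ : Plane) (hF : Integrable F) :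
    Integrable fun z => ε ^ 2 * F (ε • z + x₀) :=
  ((hF.comp_add_right x₀).comp_smul hε.ne').const_mul _

lemma integral_log_mul_rescale (hε : 0 < ε) (f : Plane → ℝ) (x₀ y : Plane) :
    ∫ z, Real.log ‖y - z‖ * (ε ^ 2 * f (ε • z + x₀)) =
      ∫ x, (Real.log ‖ε • y + x₀ - x‖ - Real.log ε) * f x := by
  rw [← integral_rescale hε x₀ fun x => (Real.log ‖ε • y + x₀ - x‖ - Real.log ε) * f x]
  refine integral_congr_ae ?_
  filter_upwards [Measure.ae_ne volume y] with z hz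
  have h1 : ε • y + x₀ - (ε • z + x₀) = ε • (y - z) := by
    rw [smul_sub]
    abel
  have h2 : ‖y - z‖ ≠ 0 := norm_ne_zero_iff.2 (sub_ne_zero.2 hz.symm)
  rw [h1, norm_smul, Real.norm_of_nonneg hε.le, Real.log_mul hε.ne' h2]
  ring

lemma abs_integral_log_mul_rescale_le (hα : 0 < α) (hα1 : α < 1) (hf : ∀ x, 0 ≤ f x)
    (hfi : Integrable f) (hf2 : Integrable fun y => f y ^ 2)
    (hfm : Integrable fun y => ‖y‖ * f y) (hε : 0 < ε) (x₀ y : Plane) :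
    |∫ z, Real.log ‖y - z‖ * (ε ^ 2 * f (ε • z + x₀))| ≤
      (Real.log (1 + ‖x₀‖) + ε * ‖y‖ + |Real.log ε|) * (∫ x, f x)
        + ((∫ x, ‖x‖ * f x) + α⁻¹ * rieszC α f) := by
  have hi := integrable_log_mul hα hα1 hf hfi hf2 hfm (ε • y + x₀)
  have h1 := abs_integral_le_integral_abs.trans
    (integral_abs_log_mul_le hα hα1 hf hfi hf2 hfm (ε • y + x₀))
  have h2 := log_one_add_norm_sub_le x₀ (-(ε • y))
  rw [sub_neg_eq_add, norm_neg, norm_smul, Real.norm_of_nonneg hε.le, add_comm x₀] at h2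
  have h0 : 0 ≤ ∫ x, f x := integral_nonneg hf
  have h3 := mul_le_mul_of_nonneg_right h2 h0
  rw [integral_log_mul_rescale hε]
  simp_rw [sub_mul]
  rw [integral_sub hi (hfi.const_mul _), integral_const_mul]
  refine (abs_sub _ _).trans ?_
  rw [abs_mul, abs_of_nonneg h0]
  linarith

lemma integrable_norm_mul_rescale (hf : ∀ x, 0 ≤ f x) (hfi : Integrable f)
    (hfm : Integrable fun y => ‖y‖ * f y) (hε : 0 < ε) (x₀ : Plane) :
    Integrable fun z => ‖z‖ * (ε ^ 2 * f (ε • z + x₀)) := by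
  have h1 : Integrable fun x => ε⁻¹ * ((‖x‖ + ‖x₀‖) * f x) := by
    simp_rw [add_mul]
    exact (hfm.add (hfi.const_mul _)).const_mul _
  refine (integrable_rescale hε x₀ h1).mono'
    (continuous_norm.aestronglyMeasurable.mul (integrable_rescale hε x₀ hfi).1)
    (ae_of_all _ fun z => ?_)
  have h2 := hf (ε • z + x₀)
  rw [Real.norm_of_nonneg (by positivity)]
  have h3 : ‖z‖ ≤ ε⁻¹ * (‖ε • z + x₀‖ + ‖x₀‖) := by
    rw [le_inv_mul_iff₀ hε]
    have := norm_sub_le (ε • z + x₀) x₀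
    rwa [add_sub_cancel_right, norm_smul, Real.norm_of_nonneg hε.le] at this
  calc _ ≤ ε⁻¹ * (‖ε • z + x₀‖ + ‖x₀‖) * (ε ^ 2 * f (ε • z + x₀)) := by gcongr
    _ = _ := by ring

lemma abs_log_potential_rescale_sub_le (hα : 0 < α) (hα1 : α < 1) (hf : ∀ x, 0 ≤ f x)
    (hfi : Integrable f) (hf2 : Integrable fun y => f y ^ 2)
    (hfm : Integrable fun y => ‖y‖ * f y) (hε : 0 < ε) (x₀ y z : Plane) :
    |(∫ p, Real.log ‖y - p‖ * (ε ^ 2 * f (ε • p + x₀)))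
        - ∫ p, Real.log ‖z - p‖ * (ε ^ 2 * f (ε • p + x₀))| ≤
      2 * α⁻¹ * (rieszJ α + ε ^ 2 * (∫ x, f x ^ 2) + ∫ x, f x) * ‖y - z‖ ^ α := by
  have h1 : ∀ p, (ε ^ 2 * f (ε • p + x₀)) ^ 2 =
      ε ^ 2 * (ε ^ 2 * f (ε • p + x₀) ^ 2) := fun p => by ring
  have h2 : Integrable fun p => (ε ^ 2 * f (ε • p + x₀)) ^ 2 := by
    simp_rw [h1]
    exact (integrable_rescale hε x₀ hf2).const_mul _
  have h := abs_log_potential_sub_le hα hα1 (fun p => mul_nonneg (sq_nonneg ε) (hf _))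
    (integrable_rescale hε x₀ hfi) h2 (integrable_norm_mul_rescale hf hfi hfm hε x₀) y z
  rw [rieszC] at h
  simp_rw [h1] at h
  rwa [integral_const_mul, integral_rescale hε x₀ fun x => f x ^ 2, integral_rescale hε] at h

end Rescaling

section Family

variable {u : ℝ → Plane → ℂ} {a : ℝ}

lemma norm_wfam_sq (Ω : ℝ) (u : ℝ → Plane → ℂ) (xa : ℝ → Plane) (a θ : ℝ) (z : Plane) :
    ‖wfam Ω u xa a θ z‖ ^ 2 = epsOf u a ^ 2 * dens (u a) (epsOf u a • z + xa a) := by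
  rw [wfam, norm_mul, norm_mul, Complex.norm_real, Complex.norm_exp, dens, mul_pow, mul_pow,
    Real.norm_eq_abs, sq_abs]
  simp

lemma epsOf_sq (h : 0 ≤ ∫ x, gradAbsSq (u a) x) :
    epsOf u a ^ 2 = (∫ x, gradAbsSq (u a) x)⁻¹ := by
  rw [epsOf, ← Real.rpow_natCast, ← Real.rpow_mul h]
  norm_num [Real.rpow_neg_one]

lemma epsOf_pos (h : 0 < ∫ x, gradAbsSq (u a) x) : 0 < epsOf u a := Real.rpow_pos_of_pos h _

lemma log_epsOf (h : 0 < ∫ x, gradAbsSq (u a) x) :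
    Real.log (epsOf u a) = -(1 : ℝ) / 2 * Real.log (∫ x, gradAbsSq (u a) x) :=
  Real.log_rpow h _

lemma integral_gradAbsSq_nonneg (v : Plane → ℂ) : 0 ≤ ∫ x, gradAbsSq v x :=
  integral_nonneg fun _ => sq_nonneg _

lemma IsGroundState.integral_sq_pos {Q : Plane → ℝ} (hQ : IsGroundState Q) :
    0 < ∫ x, Q x ^ 2 := by
  rw [integral_pos_iff_support_of_nonneg (fun x => sq_nonneg _) hQ.2.2.2.1]
  have : Function.support (fun x => Q x ^ 2) = univ :=
    eq_univ_of_forall fun x => (pow_pos (hQ.2.1 x) 2).ne'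
  rw [this]
  simp

end Family

section Final

variable {V : Plane → ℝ} {Ω b c α A A₀ : ℝ}

/-- The rescaled logarithmic potentials are bounded, uniformly in the mass, in `C^α`. -/
lemma exists_rescaled_potential_bound (hα : 0 < α) (hα1 : α < 1) (hV : V110 V)
    (hT : Trap V Ω c b) (hA₀ : 0 < A₀) (hA : A₀ ≤ A) {R : ℝ} (hR : 0 < R) :
    ∃ C, 0 < C ∧ ∀ a u x₀ ε, A₀ ≤ a → a ≤ A → Admissible V Ω a u → (∀ y, ‖u y‖ ≤ ‖u x₀‖) →
      0 < ε → ε ^ 2 = (∫ x, gradAbsSq u x)⁻¹ →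
      Real.log ε = -(1 : ℝ) / 2 * Real.log (∫ x, gradAbsSq u x) →
      (∀ y, ‖y‖ ≤ R →
        |ε ^ 2 * ∫ z, Real.log ‖y - z‖ * (ε ^ 2 * dens u (ε • z + x₀))| ≤ C) ∧
      ∀ y z, |ε ^ 2 * (∫ p, Real.log ‖y - p‖ * (ε ^ 2 * dens u (ε • p + x₀)))
        - ε ^ 2 * ∫ p, Real.log ‖z - p‖ * (ε ^ 2 * dens u (ε • p + x₀))| ≤ C * ‖y - z‖ ^ α := by
  have hA' := hA₀.trans_le hA
  obtain ⟨L, hL, hx⟩ := exists_log_max_location_bound hα hα1 hV hT hA₀ hA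
  obtain ⟨C₂, hC₂, hm⟩ := exists_norm_moment_add_rieszC_bound hα hα1 hV hT hA'
  obtain ⟨m, hm0, hgrad⟩ := exists_grad_lower_bound hα hα1 hV hT hA₀ hA
  have hJ := rieszJ_nonneg α
  set B₁ := ((L + R * (1 + m⁻¹) + (1 + m⁻¹)) * A + C₂) * (m⁻¹ + 1)
  set B₂ := m⁻¹ * (2 * α⁻¹ * (rieszJ α + 4 * A + A))
  have hB₁ : 0 < B₁ := by positivity
  have hB₂ : 0 < B₂ := by positivity
  refine ⟨B₁ + B₂, by positivity, fun a u x₀ ε haA₀ haA h hmax hε hε2 hlε => ?_⟩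
  have hN := h.grad_pos
  have h1 := hx a u x₀ haA₀ haA h hmax
  have h2 := hm a u haA h
  have h3 := hgrad a u haA₀ haA h
  have h4 := h.integral_dens_sq_le
  have hfm := h.inH.integrable_norm_mul hT
  have ha := h.mass_pos
  set N := ∫ x, gradAbsSq u x
  have hNm : N⁻¹ ≤ m⁻¹ := by gcongr
  rw [hε2]
  refine ⟨fun y hy => ?_, fun y z => ?_⟩
  · rw [← hε2]
    have h5 := abs_integral_log_mul_rescale_le hα hα1 (dens_nonneg u) h.integrable_dens
      h.integrable_dens_sq hfm hε x₀ y
    rw [h.mass] at h5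
    have hm1 : 0 < m⁻¹ := inv_pos.2 hm0
    have h6 : ε * ‖y‖ ≤ R * (1 + m⁻¹) * (1 + N) := by
      have h7 : ε ≤ 1 + m⁻¹ := by nlinarith [sq_nonneg (ε - 1)]
      calc ε * ‖y‖ ≤ (1 + m⁻¹) * R := by gcongr
        _ = R * (1 + m⁻¹) * 1 := by ring
        _ ≤ _ := by
          gcongr
          linarith
    have h7 : |Real.log ε| ≤ (1 + m⁻¹) * (1 + N) := by
      have h8 := Real.log_le_sub_one_of_pos hN
      have h9 := Real.log_le_sub_one_of_pos (inv_pos.2 hN)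
      rw [Real.log_inv] at h9
      have h10 : 0 < m⁻¹ * N := by positivity
      rw [hlε, abs_le]
      constructor <;> linarith
    have h8 : (Real.log (1 + ‖x₀‖) + ε * ‖y‖ + |Real.log ε|) * a ≤
        ((L + R * (1 + m⁻¹) + (1 + m⁻¹)) * (1 + N)) * A := by
      gcongr
      linarith
    have h9 : |∫ z, Real.log ‖y - z‖ * (ε ^ 2 * dens u (ε • z + x₀))| ≤
        ((L + R * (1 + m⁻¹) + (1 + m⁻¹)) * A + C₂) * (1 + N) := by linarith
    rw [abs_mul, abs_of_pos (by positivity)]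
    calc _ ≤ ε ^ 2 * (((L + R * (1 + m⁻¹) + (1 + m⁻¹)) * A + C₂) * (1 + N)) := by gcongr
      _ = ((L + R * (1 + m⁻¹) + (1 + m⁻¹)) * A + C₂) * (N⁻¹ + 1) := by
        rw [hε2]
        field_simp
      _ ≤ B₁ := by
        simp only [B₁]
        gcongr
      _ ≤ B₁ + B₂ := by linarith
  · rw [← hε2]
    have h5 := abs_log_potential_rescale_sub_le hα hα1 (dens_nonneg u) h.integrable_dens
      h.integrable_dens_sq hfm hε x₀ y z
    rw [h.mass] at h5
    have h6 : ε ^ 2 * (∫ x, dens u x ^ 2) ≤ 4 * A :=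
      calc _ ≤ ε ^ 2 * (4 * a * N) := by gcongr
        _ = 4 * a := by
          rw [hε2]
          field_simp
        _ ≤ _ := by gcongr
    have h7 : 0 ≤ ‖y - z‖ ^ α := by positivity
    rw [← mul_sub, abs_mul, abs_of_pos (by positivity)]
    calc _ ≤ ε ^ 2 * (2 * α⁻¹ * (rieszJ α + ε ^ 2 * (∫ x, dens u x ^ 2) + a) * ‖y - z‖ ^ α) := by
          gcongr
      _ ≤ m⁻¹ * (2 * α⁻¹ * (rieszJ α + 4 * A + A) * ‖y - z‖ ^ α) := by
        have h8 : 0 ≤ ∫ x, dens u x ^ 2 := integral_nonneg fun x => sq_nonneg _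
        rw [hε2] at h6 ⊢
        gcongr
      _ = B₂ * ‖y - z‖ ^ α := by ring
      _ ≤ (B₁ + B₂) * ‖y - z‖ ^ α := by
        gcongr
        linarith

end Final

theorem log_potential_holder_bounds
    (V : Plane → ℝ) (Ω α : ℝ) (Q : Plane → ℝ)
    (hV : V110 V) (hΩ : 0 < Ω) (hsub : SubCritical V Ω) (hCV : CondV V Ω α)
    (hQ : IsGroundState Q)
    (astar : ℝ) (hastar : astar = ∫ x : Plane, (Q x) ^ 2)
    (u : ℝ → Plane → ℂ)
    (hmin : ∀ a ∈ Ioo (0 : ℝ) astar, IsMinimizer V Ω a (u a))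
    (xa : ℝ → Plane) (θ : ℝ → ℝ)
    (hxa : ∀ a ∈ Ioo (0 : ℝ) astar, ∀ y : Plane, ‖u a y‖ ≤ ‖u a (xa a)‖)
    (hθ : ∀ a, θ a ∈ Ico (0 : ℝ) (2 * Real.pi))
 :
    ∀ R : ℝ, 0 < R → ∃ C : ℝ, 0 < C ∧ ∀ᶠ a in 𝓝[<] astar,
      (∀ y ∈ closedBall (0 : Plane) R,
        |(epsOf u a) ^ 2 * ∫ z : Plane, Real.log ‖y - z‖ * ‖wfam Ω u xa a (θ a) z‖ ^ 2| ≤ C) ∧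
      (∀ y ∈ closedBall (0 : Plane) R, ∀ z ∈ closedBall (0 : Plane) R,
        |(epsOf u a) ^ 2 * (∫ p : Plane, Real.log ‖y - p‖ * ‖wfam Ω u xa a (θ a) p‖ ^ 2)
            - (epsOf u a) ^ 2 * (∫ p : Plane, Real.log ‖z - p‖ * ‖wfam Ω u xa a (θ a) p‖ ^ 2)|
          ≤ C * ‖y - z‖ ^ α) := by
  intro R hR
  obtain ⟨hα, hα1⟩ := hCV.1
  obtain ⟨c, b, hT⟩ := exists_trap hV hΩ hsub hCV
  have hpos : 0 < astar := hastar ▸ hQ.integral_sq_pos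
  obtain ⟨C, hC, hbound⟩ := exists_rescaled_potential_bound hα hα1 hV hT (half_pos hpos)
    (half_le_self hpos.le) hR
  refine ⟨C, hC, ?_⟩
  filter_upwards [Ioo_mem_nhdsLT (half_lt_self hpos)] with a ha
  have ha' : a ∈ Ioo 0 astar := ⟨(half_pos hpos).trans ha.1, ha.2⟩
  simp_rw [norm_wfam_sq]
  obtain h0 | hN := (integral_gradAbsSq_nonneg (u a)).eq_or_lt
  · have hε : epsOf u a ^ 2 = 0 := by rw [epsOf_sq h0.le, ← h0, inv_zero]
    simp only [hε, zero_mul, sub_self, abs_zero]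
    exact ⟨fun _ _ => hC.le, fun _ _ _ _ => by positivity⟩
  · have h : Admissible V Ω a (u a) :=
      ⟨hmin a ha', Integrable.of_integral_ne_zero hN.ne', hN, ha'.1⟩
    obtain ⟨h1, h2⟩ := hbound a (u a) (xa a) (epsOf u a) ha.1.le ha.2.le h (hxa a ha')
      (epsOf_pos hN) (epsOf_sq hN.le) (log_epsOf hN)
    exact ⟨fun y hy => h1 y (mem_closedBall_zero_iff.1 hy), fun y _ z _ => h2 y z⟩

end
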